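/- arXiv:2507.01596 — 2 statements merged into one kernel-verified Lean document; each statement's English description precedes it below -/
import Mathlib

section
/- Let F be the 5-vertex graph with vertex set {0,1,2,3,4} and edge set {01, 12, 23, 30, 04} (the 4-cycle with a pendant edge). Then the inducibility constant λ_F equals 5^6/(2^8·3^5) = 15625/62208. -/
open Finset
open scoped Classical

/-- Number of `κ`-element vertex subsets of `G` inducing a subgraph isomorphic to `F`. -/
noncomputable def numCopies {κ n : ℕ} (F : SimpleGraph (Fin κ)) (G : SimpleGraph (Fin n)) : ℕ :=
  ((Finset.powersetCard κ Finset.univ).filter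
    (fun S : Finset (Fin n) => Nonempty (F ≃g (G.induce (S : Set (Fin n)))))).card

/-- `λ_F(G)`: induced density of `F` in `G`. -/
noncomputable def lamF {κ n : ℕ} (F : SimpleGraph (Fin κ)) (G : SimpleGraph (Fin n)) : ℝ :=
  (numCopies F G : ℝ) / (n.choose κ : ℝ)

/-- `λ_F(n)`: the maximum of `λ_F(G)` over all graphs `G` on `n` vertices. -/
noncomputable def lamFmax {κ : ℕ} (F : SimpleGraph (Fin κ)) (n : ℕ) : ℝ :=
  ⨆ G : SimpleGraph (Fin n), lamF F G

/-- Edit distance between two graphs on `Fin n`: the minimum over bijections of the number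
of vertex pairs whose adjacency must be changed in `G` to obtain a graph isomorphic to `H`. -/
noncomputable def editDist {n : ℕ} (G H : SimpleGraph (Fin n)) : ℕ :=
  ⨅ σ : Equiv.Perm (Fin n),
    (Finset.univ.filter (fun p : Fin n × Fin n =>
      p.1 < p.2 ∧ ¬ (G.Adj p.1 p.2 ↔ H.Adj (σ p.1) (σ p.2)))).card

/-- Edit distance of `G` to the family of `n`-vertex graphs satisfying `P`. -/
noncomputable def distToFam {n : ℕ} (G : SimpleGraph (Fin n))
    (P : SimpleGraph (Fin n) → Prop) : ℕ :=
  ⨅ H : {H : SimpleGraph (Fin n) // P H}, editDist G H.1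

/-- A vertex-disjoint union of two complete bipartite graphs (with possibly empty parts):
a blowup of the pattern `2K₂`. -/
def isBlowup2K2 {n : ℕ} (G : SimpleGraph (Fin n)) : Prop :=
  ∃ c : Fin n → Fin 2 × Fin 2, ∀ u v,
    G.Adj u v ↔ ((c u).1 = (c v).1 ∧ (c u).2 ≠ (c v).2)

/-- The 4-cycle with a pendant edge: edges `{01, 12, 23, 30, 04}` on `{0,1,2,3,4}`. -/
def fourCyclePendant : SimpleGraph (Fin 5) :=
  SimpleGraph.fromRel (fun a b =>
    (a = 0 ∧ b = 1) ∨ (a = 1 ∧ b = 2) ∨ (a = 2 ∧ b = 3) ∨ (a = 3 ∧ b = 0) ∨ (a = 0 ∧ b = 4))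

/-- Lookup of an integer by a three-bit adjacency pattern. -/
def look (c0 c1 c2 c3 c4 c5 c6 c7 : ℤ) (a b c : Bool) : ℤ :=
  bif c then (bif b then (bif a then c7 else c6) else (bif a then c5 else c4))
  else (bif b then (bif a then c3 else c2) else (bif a then c1 else c0))

/-- Coefficients of a square used for triples spanning 0 edge(s). -/
def sq1a : Bool → Bool → Bool → ℤ :=
  look 390625 (-655200) (-655200) 938945 (-655200) 938945 938945 (-1162868)

/-- Coefficients of a square used for triples spanning 0 edge(s). -/
def sq1b : Bool → Bool → Bool → ℤ :=
  look 0 25 25 (-40) 25 (-40) (-40) 21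

/-- Coefficients of a square used for triples spanning 1 edge(s). -/
def sq2a : Bool → Bool → Bool → ℤ :=
  look 2482275 (-1987175) (-1131000) 1285798 (-1131000) 1285798 (-211200) 0

/-- Coefficients of a square used for triples spanning 1 edge(s). -/
def sq2b : Bool → Bool → Bool → ℤ :=
  look 0 310097340715 130161873000 (-244246090343) 130161873000 (-244246090343) (-311513244000) 0

/-- Coefficients of a square used for triples spanning 1 edge(s). -/
def sq2c : Bool → Bool → Bool → ℤ :=
  look 0 0 81298169761326655 (-113817437665857317) 81298169761326655 (-113817437665857317) (-403051995422400) 0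

/-- Coefficients of a square used for triples spanning 1 edge(s). -/
def sq2d : Bool → Bool → Bool → ℤ :=
  look 0 0 0 0 0 0 1 0

/-- Coefficients of a square used for triples spanning 2 edge(s). -/
def sq3a : Bool → Bool → Bool → ℤ :=
  look 122803200 57386695 57386695 (-44618818) (-10600630) 28056000 28056000 0

/-- Coefficients of a square used for triples spanning 2 edge(s). -/
def sq3b : Bool → Bool → Bool → ℤ :=
  look 0 424651812473155 424651812473155 (-143074332674698) (-22321993595470) (-182012574984000) (-182012574984000) 0

/-- Coefficients of a square used for triples spanning 2 edge(s). -/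
def sq3c : Bool → Bool → Bool → ℤ :=
  look 0 0 0 877847568354699926466 (-731539640295583272055) 277724829148069663250 277724829148069663250 0

/-- Coefficients of a square used for triples spanning 2 edge(s). -/
def sq3d : Bool → Bool → Bool → ℤ :=
  look 0 0 0 0 0 1 1 0

/-- Coefficients of a square used for triples spanning 2 edge(s). -/
def sq3e : Bool → Bool → Bool → ℤ :=
  look 0 1 (-1) 0 0 0 0 0

/-- Positive semidefinite form for triples spanning 0 edge(s). -/
def quad1 (a b c aa bb cc : Bool) : ℤ :=
    2716230873810210256899696829796011871449021417800457059515816178667352064 * (sq1a a b c * sq1a aa bb cc) +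
    1058693725676559725095259413042309296940065219388758646938577896518987976396079104 * (sq1b a b c * sq1b aa bb cc)

/-- Positive semidefinite form for triples spanning 1 edge(s). -/
def quad2 (a b c aa bb cc : Bool) : ℤ :=
    1282324905679805881622435959922732739867388574587791689728211855808000000 * (sq2a a b c * sq2a aa bb cc) +
    20676167404775447972877595464076483024724615536079278656000000 * (sq2b a b c * sq2b aa bb cc) +
    315652453157092151162767388633207340978299040000000 * (sq2c a b c * sq2c aa bb cc) +
    2781927202472468425566363019204962295018883713467734907641711795948315520000000000 * (sq2d a b c * sq2d aa bb cc)

/-- Positive semidefinite form for triples spanning 2 edge(s). -/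
def quad3 (a b c aa bb cc : Bool) : ℤ :=
    1296009817026893494959550004567145404946419138094492088406530564503125 * (sq3a a b c * sq3a aa bb cc) +
    15259676032924299546941420023194577664153391851745971875 * (sq3b a b c * sq3b aa bb cc) +
    8197229818684255966224816387319341926400000 * (sq3c a b c * sq3c aa bb cc) +
    395536625073741075531006438470280577828936428186768585091857936742295307840000000000 * (sq3d a b c * sq3d aa bb cc) +
    11980665022542584924105848549659581850550813794165184814676388191322752933515460000000 * (sq3e a b c * sq3e aa bb cc)

/-- The form attached to a triple with edge pattern `t01 t02 t12` and two further vertices. -/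
def tri (t01 t02 t12 a b c aa bb cc : Bool) : ℤ :=
  match t01, t02, t12 with
  | false, false, false => 3 * quad1 a b c aa bb cc
  | false, false, true => quad2 a b c aa bb cc
  | false, true, false => quad2 b a c bb aa cc
  | true, false, false => quad2 c a b cc aa bb
  | false, true, true => quad3 a b c aa bb cc
  | true, false, true => quad3 a c b aa cc bb
  | true, true, false => quad3 b c a bb cc aa
  | true, true, true => 0

/-- Sum of the forms over all triples of a five-vertex graph. -/
def triSum (b01 b02 b03 b04 b12 b13 b14 b23 b24 b34 : Bool) : ℤ :=
  tri b01 b02 b12 b03 b13 b23 b04 b14 b24 +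
  tri b01 b03 b13 b02 b12 b23 b04 b14 b34 +
  tri b01 b04 b14 b02 b12 b24 b03 b13 b34 +
  tri b02 b03 b23 b01 b12 b13 b04 b24 b34 +
  tri b02 b04 b24 b01 b12 b14 b03 b23 b34 +
  tri b03 b04 b34 b01 b13 b14 b02 b23 b24 +
  tri b12 b13 b23 b01 b02 b03 b14 b24 b34 +
  tri b12 b14 b24 b01 b02 b04 b13 b23 b34 +
  tri b13 b14 b34 b01 b03 b04 b12 b23 b24 +
  tri b23 b24 b34 b02 b03 b04 b12 b13 b14

/-- Recognises the four-cycle with a pendant edge. -/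
def isF (b01 b02 b03 b04 b12 b13 b14 b23 b24 b34 : Bool) : Bool :=
  (b01.toNat + b02.toNat + b03.toNat + b04.toNat + b12.toNat + b13.toNat + b14.toNat + b23.toNat + b24.toNat + b34.toNat == 5) &&
  !((b01 && b02 && b12) ||
    (b01 && b03 && b13) ||
    (b01 && b04 && b14) ||
    (b02 && b03 && b23) ||
    (b02 && b04 && b24) ||
    (b03 && b04 && b34) ||
    (b12 && b13 && b23) ||
    (b12 && b14 && b24) ||
    (b13 && b14 && b34) || (b23 && b24 && b34)) &&
  ((b01.toNat + b02.toNat + b03.toNat + b04.toNat == 1) ||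
    (b01.toNat + b12.toNat + b13.toNat + b14.toNat == 1) ||
    (b02.toNat + b12.toNat + b23.toNat + b24.toNat == 1) ||
    (b03.toNat + b13.toNat + b23.toNat + b34.toNat == 1) ||
    (b04.toNat + b14.toNat + b24.toNat + b34.toNat == 1))

/-- The common denominator of the certificate. -/
def cD : ℤ := 1650110255839702731066565824101077211905280511313777663655858328540416378880000000000

/-- The certified bound, scaled. -/
def cK : ℤ := 12433918184556016190641922743817193015055945210878557096172254235842981250000000000000

theorem pointwise : ∀ b01 b02 b03 b04 b12 b13 b14 b23 b24 b34 : Bool,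
    (bif isF b01 b02 b03 b04 b12 b13 b14 b23 b24 b34 then 30 * cD else 0) +
      triSum b01 b02 b03 b04 b12 b13 b14 b23 b24 b34 ≤ cK := by
  decide +kernel

theorem cK_eq : cK * 62208 = 30 * cD * 15625 := by decide
theorem sum_form_nonneg {V : Type*} [Fintype V] (w : ℤ) (hw : 0 ≤ w) (f : V → ℤ) :
    0 ≤ ∑ u, ∑ v, w * (f u * f v) := by
  have h : ∑ u, ∑ v, w * (f u * f v) = w * ((∑ u, f u) * (∑ v, f v)) := by
    rw [Finset.sum_mul_sum, Finset.mul_sum]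
    refine Finset.sum_congr rfl fun u _ => ?_
    rw [Finset.mul_sum]
  rw [h]
  exact mul_nonneg hw (mul_self_nonneg _)

theorem quad1_nonneg {V : Type*} [Fintype V] (a b c : V → Bool) :
    0 ≤ ∑ u, ∑ v, quad1 (a u) (b u) (c u) (a v) (b v) (c v) := by
  simp only [quad1, Finset.sum_add_distrib]
  have k1 := fun w hw => sum_form_nonneg w hw (fun u => sq1a (a u) (b u) (c u))
  have k2 := fun w hw => sum_form_nonneg w hw (fun u => sq1b (a u) (b u) (c u))
  exact add_nonneg (k1 _ (by norm_num)) (k2 _ (by norm_num))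

theorem quad2_nonneg {V : Type*} [Fintype V] (a b c : V → Bool) :
    0 ≤ ∑ u, ∑ v, quad2 (a u) (b u) (c u) (a v) (b v) (c v) := by
  simp only [quad2, Finset.sum_add_distrib]
  have k1 := fun w hw => sum_form_nonneg w hw (fun u => sq2a (a u) (b u) (c u))
  have k2 := fun w hw => sum_form_nonneg w hw (fun u => sq2b (a u) (b u) (c u))
  have k3 := fun w hw => sum_form_nonneg w hw (fun u => sq2c (a u) (b u) (c u))
  have k4 := fun w hw => sum_form_nonneg w hw (fun u => sq2d (a u) (b u) (c u))
  exact add_nonneg (add_nonneg (add_nonneg (k1 _ (by norm_num)) (k2 _ (by norm_num)))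
    (k3 _ (by norm_num))) (k4 _ (by norm_num))

theorem quad3_nonneg {V : Type*} [Fintype V] (a b c : V → Bool) :
    0 ≤ ∑ u, ∑ v, quad3 (a u) (b u) (c u) (a v) (b v) (c v) := by
  simp only [quad3, Finset.sum_add_distrib]
  have k1 := fun w hw => sum_form_nonneg w hw (fun u => sq3a (a u) (b u) (c u))
  have k2 := fun w hw => sum_form_nonneg w hw (fun u => sq3b (a u) (b u) (c u))
  have k3 := fun w hw => sum_form_nonneg w hw (fun u => sq3c (a u) (b u) (c u))
  have k4 := fun w hw => sum_form_nonneg w hw (fun u => sq3d (a u) (b u) (c u))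
  have k5 := fun w hw => sum_form_nonneg w hw (fun u => sq3e (a u) (b u) (c u))
  exact add_nonneg (add_nonneg (add_nonneg (add_nonneg (k1 _ (by norm_num)) (k2 _ (by norm_num)))
    (k3 _ (by norm_num))) (k4 _ (by norm_num))) (k5 _ (by norm_num))

theorem tri_nonneg {V : Type*} [Fintype V] (t01 t02 t12 : Bool) (a b c : V → Bool) :
    0 ≤ ∑ u, ∑ v, tri t01 t02 t12 (a u) (b u) (c u) (a v) (b v) (c v) := by
  cases t01 <;> cases t02 <;> cases t12 <;> simp only [tri]
  · simp only [← Finset.mul_sum]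
    exact mul_nonneg (by norm_num) (quad1_nonneg a b c)
  · exact quad2_nonneg a b c
  · exact quad2_nonneg b a c
  · exact quad3_nonneg a b c
  · exact quad2_nonneg c a b
  · exact quad3_nonneg a c b
  · exact quad3_nonneg b c a
  · simp

/-- Quintuples as functions on `Fin 5`. -/
def quintEquiv (V : Type*) : (V × V × V × V × V) ≃ (Fin 5 → V) where
  toFun p := ![p.1, p.2.1, p.2.2.1, p.2.2.2.1, p.2.2.2.2]
  invFun x := (x 0, x 1, x 2, x 3, x 4)
  left_inv p := rfl
  right_inv x := by
    ext i
    fin_cases i <;> rfl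

/-- Sum over all quintuples of the form on the first three vertices is nonnegative. -/
theorem tri_sum_nonneg0 {V : Type*} [Fintype V] (A : V → V → Bool) :
    0 ≤ ∑ x : Fin 5 → V, tri (A (x 0) (x 1)) (A (x 0) (x 2)) (A (x 1) (x 2))
      (A (x 0) (x 3)) (A (x 1) (x 3)) (A (x 2) (x 3))
      (A (x 0) (x 4)) (A (x 1) (x 4)) (A (x 2) (x 4)) := by
  rw [← (quintEquiv V).sum_comp]
  simp only [Fintype.sum_prod_type]
  refine Finset.sum_nonneg fun y0 _ => Finset.sum_nonneg fun y1 _ => Finset.sum_nonneg fun y2 _ => ?_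
  exact tri_nonneg (A y0 y1) (A y0 y2) (A y1 y2) (A y0) (A y1) (A y2)

theorem tri_sum_nonneg {V : Type*} [Fintype V] (A : V → V → Bool) (i : Fin 5 → Fin 5)
    (hi : Function.Bijective i) :
    0 ≤ ∑ x : Fin 5 → V, tri (A (x (i 0)) (x (i 1))) (A (x (i 0)) (x (i 2))) (A (x (i 1)) (x (i 2)))
      (A (x (i 0)) (x (i 3))) (A (x (i 1)) (x (i 3))) (A (x (i 2)) (x (i 3)))
      (A (x (i 0)) (x (i 4))) (A (x (i 1)) (x (i 4))) (A (x (i 2)) (x (i 4))) := by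
  have h := (Equiv.arrowCongr (Equiv.ofBijective i hi).symm (Equiv.refl V)).sum_comp
    (fun x : Fin 5 → V => tri (A (x 0) (x 1)) (A (x 0) (x 2)) (A (x 1) (x 2))
      (A (x 0) (x 3)) (A (x 1) (x 3)) (A (x 2) (x 3))
      (A (x 0) (x 4)) (A (x 1) (x 4)) (A (x 2) (x 4)))
  have h0 := tri_sum_nonneg0 A
  rw [← h] at h0
  exact h0

theorem triSum_nonneg {V : Type*} [Fintype V] (A : V → V → Bool) (hA : ∀ u v, A u v = A v u) :
    0 ≤ ∑ x : Fin 5 → V, triSum (A (x 0) (x 1)) (A (x 0) (x 2)) (A (x 0) (x 3)) (A (x 0) (x 4))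
      (A (x 1) (x 2)) (A (x 1) (x 3)) (A (x 1) (x 4)) (A (x 2) (x 3)) (A (x 2) (x 4))
      (A (x 3) (x 4)) := by
  have key := fun i hi => tri_sum_nonneg A i hi
  have k1 := key ![0, 1, 2, 3, 4] (by decide)
  have k2 := key ![0, 1, 3, 2, 4] (by decide)
  have k3 := key ![0, 1, 4, 2, 3] (by decide)
  have k4 := key ![0, 2, 3, 1, 4] (by decide)
  have k5 := key ![0, 2, 4, 1, 3] (by decide)
  have k6 := key ![0, 3, 4, 1, 2] (by decide)
  have k7 := key ![1, 2, 3, 0, 4] (by decide)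
  have k8 := key ![1, 2, 4, 0, 3] (by decide)
  have k9 := key ![1, 3, 4, 0, 2] (by decide)
  have k10 := key ![2, 3, 4, 0, 1] (by decide)
  simp only [triSum, Finset.sum_add_distrib]
  refine add_nonneg (add_nonneg (add_nonneg (add_nonneg (add_nonneg (add_nonneg (add_nonneg
    (add_nonneg (add_nonneg ?_ ?_) ?_) ?_) ?_) ?_) ?_) ?_) ?_) ?_
  · exact k1
  · refine k2.trans_eq (Finset.sum_congr rfl fun x _ => ?_)
    simp [hA (x 3) (x 2)]
  · refine k3.trans_eq (Finset.sum_congr rfl fun x _ => ?_)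
    simp [hA (x 4) (x 2), hA (x 4) (x 3)]
  · refine k4.trans_eq (Finset.sum_congr rfl fun x _ => ?_)
    simp [hA (x 2) (x 1), hA (x 3) (x 1)]
  · refine k5.trans_eq (Finset.sum_congr rfl fun x _ => ?_)
    simp [hA (x 2) (x 1), hA (x 4) (x 1), hA (x 4) (x 3)]
  · refine k6.trans_eq (Finset.sum_congr rfl fun x _ => ?_)
    simp [hA (x 3) (x 1), hA (x 4) (x 1), hA (x 3) (x 2), hA (x 4) (x 2)]
  · refine k7.trans_eq (Finset.sum_congr rfl fun x _ => ?_)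
    simp [hA (x 1) (x 0), hA (x 2) (x 0), hA (x 3) (x 0)]
  · refine k8.trans_eq (Finset.sum_congr rfl fun x _ => ?_)
    simp [hA (x 1) (x 0), hA (x 2) (x 0), hA (x 4) (x 0), hA (x 4) (x 3)]
  · refine k9.trans_eq (Finset.sum_congr rfl fun x _ => ?_)
    simp [hA (x 1) (x 0), hA (x 3) (x 0), hA (x 4) (x 0), hA (x 3) (x 2), hA (x 4) (x 2)]
  · refine k10.trans_eq (Finset.sum_congr rfl fun x _ => ?_)
    simp [hA (x 2) (x 0), hA (x 3) (x 0), hA (x 4) (x 0), hA (x 2) (x 1), hA (x 3) (x 1),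
      hA (x 4) (x 1)]

/-- The recogniser applied to a quintuple. -/
def isFat {V : Type*} (A : V → V → Bool) (x : Fin 5 → V) : Bool :=
  isF (A (x 0) (x 1)) (A (x 0) (x 2)) (A (x 0) (x 3)) (A (x 0) (x 4))
      (A (x 1) (x 2)) (A (x 1) (x 3)) (A (x 1) (x 4)) (A (x 2) (x 3)) (A (x 2) (x 4))
      (A (x 3) (x 4))

theorem card_isFat_le {V : Type*} [Fintype V] (A : V → V → Bool) (hA : ∀ u v, A u v = A v u) :
    ((Finset.univ.filter (fun x : Fin 5 → V => isFat A x = true)).card : ℤ) * 62208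
      ≤ 15625 * (Fintype.card V : ℤ) ^ 5 := by
  have h1 : ∑ x : Fin 5 → V, ((bif isFat A x then 30 * cD else 0) +
      triSum (A (x 0) (x 1)) (A (x 0) (x 2)) (A (x 0) (x 3)) (A (x 0) (x 4))
      (A (x 1) (x 2)) (A (x 1) (x 3)) (A (x 1) (x 4)) (A (x 2) (x 3)) (A (x 2) (x 4))
      (A (x 3) (x 4))) ≤ ∑ x : Fin 5 → V, cK :=
    Finset.sum_le_sum fun x _ => pointwise _ _ _ _ _ _ _ _ _ _
  rw [Finset.sum_add_distrib] at h1
  have h2 := triSum_nonneg A hA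
  have h3 : ∑ x : Fin 5 → V, (bif isFat A x then 30 * cD else 0) =
      ((Finset.univ.filter (fun x : Fin 5 → V => isFat A x = true)).card : ℤ) * (30 * cD) := by
    rw [Finset.card_filter]
    push_cast
    rw [Finset.sum_mul]
    refine Finset.sum_congr rfl fun x _ => ?_
    cases isFat A x <;> simp
  have h4 : ∑ x : Fin 5 → V, cK = (Fintype.card V : ℤ) ^ 5 * cK := by
    simp
  rw [h3, h4] at h1
  have hD : 0 < 30 * cD := by decide
  have := cK_eq
  have h5 : ((Finset.univ.filter (fun x : Fin 5 → V => isFat A x = true)).card : ℤ) * (30 * cD)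
    ≤ (Fintype.card V : ℤ) ^ 5 * cK := by linarith
  refine le_of_mul_le_mul_left ?_ hD
  calc _ = ((Finset.univ.filter (fun x : Fin 5 → V => isFat A x = true)).card : ℤ) * (30 * cD)
          * 62208 := by ring
    _ ≤ (Fintype.card V : ℤ) ^ 5 * cK * 62208 := by gcongr
    _ = (Fintype.card V : ℤ) ^ 5 * (cK * 62208) := by ring
    _ = _ := by rw [this]; ring

/-- Boolean adjacency of the four-cycle with a pendant edge. -/
def adjF (a b : Fin 5) : Bool :=
  (a == 0 && b == 1) || (a == 1 && b == 2) || (a == 2 && b == 3) || (a == 3 && b == 0) ||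
  (a == 0 && b == 4) || (b == 0 && a == 1) || (b == 1 && a == 2) || (b == 2 && a == 3) ||
  (b == 3 && a == 0) || (b == 0 && a == 4)

theorem adjF_iff (a b : Fin 5) : fourCyclePendant.Adj a b ↔ adjF a b = true := by
  simp only [fourCyclePendant, SimpleGraph.fromRel_adj]
  revert a b
  decide

theorem isFat_perm : ∀ σ : Equiv.Perm (Fin 5), isFat adjF σ = true := by
  decide +kernel

theorem numCopies_le {n : ℕ} (G : SimpleGraph (Fin n)) :
    (numCopies fourCyclePendant G : ℤ) * 120 * 62208 ≤ 15625 * (n : ℤ) ^ 5 := by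
  rcases Nat.eq_zero_or_pos n with hn0 | hn0
  · subst hn0
    have h0 : numCopies fourCyclePendant G = 0 := by
      rw [numCopies, Finset.powersetCard_eq_empty.2 (by simp)]
      simp
    simp [h0]
  have h := card_isFat_le (fun u v : Fin n => decide (G.Adj u v)) (fun u v => by
    simp [G.adj_comm])
  rw [Fintype.card_fin] at h
  refine le_trans ?_ h
  refine mul_le_mul_of_nonneg_right ?_ (by norm_num)
  have key : numCopies fourCyclePendant G * 120 ≤ (Finset.univ.filter (fun x : Fin 5 → Fin n =>
      isFat (fun u v : Fin n => decide (G.Adj u v)) x = true)).card := by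
    have h120 : (Finset.univ : Finset (Equiv.Perm (Fin 5))).card = 120 := by
      rw [Finset.card_univ, Fintype.card_perm]; rfl
    rw [numCopies, ← h120, ← Finset.card_product]
    have hex : ∀ S : Finset (Fin n), ∃ x : Fin 5 → Fin n,
        Nonempty (fourCyclePendant ≃g (G.induce (S : Set (Fin n)))) →
        Function.Injective x ∧ Set.range x = S ∧
          ∀ i j, G.Adj (x i) (x j) ↔ fourCyclePendant.Adj i j := by
      intro S
      by_cases hS : Nonempty (fourCyclePendant ≃g (G.induce (S : Set (Fin n))))
      · obtain ⟨e⟩ := hS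
        refine ⟨fun i => (e i).1, fun _ => ⟨?_, ?_, ?_⟩⟩
        · intro i j hij
          exact e.injective (Subtype.ext hij)
        · ext v
          constructor
          · rintro ⟨i, rfl⟩
            exact (e i).2
          · intro hv
            obtain ⟨i, hi⟩ := e.surjective ⟨v, hv⟩
            exact ⟨i, by simp [hi]⟩
        · intro i j
          exact e.map_rel_iff
      · exact ⟨fun _ => ⟨0, hn0⟩, fun h => absurd h hS⟩
    choose X hX using hex
    refine Finset.card_le_card_of_injOn (fun p => X p.1 ∘ p.2) ?_ ?_
    · rintro ⟨S, σ⟩ hp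
      simp only [Finset.coe_product, Finset.coe_filter, Set.mem_prod, Set.mem_ofPred_eq] at hp
      obtain ⟨hinj, hr, hadj⟩ := hX S hp.1.2
      simp only [Finset.coe_filter, Set.mem_ofPred_eq, Finset.mem_univ, true_and]
      have hs := isFat_perm σ
      have hh : ∀ i j, decide (G.Adj (X S i) (X S j)) = adjF i j := by
        intro i j
        rw [Bool.eq_iff_iff, decide_eq_true_iff, hadj, adjF_iff]
      simp only [isFat, Function.comp_apply, hh] at hs ⊢
      exact hs
    · rintro ⟨S, σ⟩ hp ⟨S', σ'⟩ hp' heq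
      simp only [Finset.coe_product, Finset.coe_filter, Set.mem_prod, Set.mem_ofPred_eq] at hp hp'
      obtain ⟨hinj, hr, hadj⟩ := hX S hp.1.2
      obtain ⟨hinj', hr', hadj'⟩ := hX S' hp'.1.2
      simp only at heq
      have hSS : S = S' := by
        have e1 : Set.range (X S ∘ σ) = S := by rw [EquivLike.range_comp, hr]
        have e2 : Set.range (X S' ∘ σ') = S' := by rw [EquivLike.range_comp, hr']
        rw [heq, e2] at e1
        exact (Finset.coe_injective e1).symm
      subst hSS
      congr 1
      ext i
      exact congrArg _ (hinj (congrFun heq i))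
  exact_mod_cast key

theorem cylinder_card {α β : Type*} [Fintype α] [DecidableEq α] [Fintype β] {k : ℕ}
    (ι : Fin k → α) (hι : Function.Injective ι) (Q : (Fin k → β) → Prop) :
    (Finset.univ.filter (fun f : α → β => Q (f ∘ ι))).card * Fintype.card β ^ k =
      (Finset.univ.filter Q).card * Fintype.card (α → β) := by
  let C := {a : α // a ∉ Set.range ι}
  let e1 : Fin k ⊕ C ≃ α :=
    (Equiv.sumCongr (Equiv.ofInjective ι hι) (Equiv.refl _)).trans (Equiv.Set.sumCompl (Set.range ι))
  let e : (α → β) ≃ (Fin k → β) × (C → β) :=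
    (Equiv.arrowCongr e1.symm (Equiv.refl β)).trans (Equiv.sumArrowEquivProdArrow _ _ _)
  have he : ∀ f, (e f).1 = f ∘ ι := fun f => rfl
  have h1 : (Finset.univ.filter (fun f : α → β => Q (f ∘ ι))).card =
      ((Finset.univ.filter Q) ×ˢ (Finset.univ : Finset (C → β))).card := by
    refine Finset.card_equiv e fun f => ?_
    simp [he]
  have h2 : Fintype.card (α → β) = Fintype.card β ^ k * Fintype.card (C → β) := by
    rw [Fintype.card_congr e, Fintype.card_prod, Fintype.card_fun, Fintype.card_fin]
  rw [h1, h2, Finset.card_product, Finset.card_univ]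
  ring

/-- The graph built from a colouring and labels of pairs. -/
def ranG {n : ℕ} (c : Fin n → Bool) (w : Sym2 (Fin n) → Fin 6) : SimpleGraph (Fin n) where
  Adj u v := c u ≠ c v ∧ w s(u, v) ≠ 0
  symm := ⟨fun u v h => ⟨h.1.symm, by rw [Sym2.eq_swap]; exact h.2⟩⟩
  loopless := ⟨fun u h => h.1 rfl⟩

/-- `x` is an induced labelled copy of the four-cycle with a pendant edge. -/
def Lab {n : ℕ} (G : SimpleGraph (Fin n)) (x : Fin 5 ↪ Fin n) : Prop :=
  ∀ i j, G.Adj (x i) (x j) ↔ fourCyclePendant.Adj i j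

/-- The six relevant pairs. -/
def sixPairs {n : ℕ} (x : Fin 5 ↪ Fin n) : Fin 6 → Sym2 (Fin n) :=
  fun i => Sym2.map x (![s(0, 1), s(1, 2), s(2, 3), s(3, 0), s(0, 4), s(2, 4)] i)

theorem sixPairs_inj {n : ℕ} (x : Fin 5 ↪ Fin n) : Function.Injective (sixPairs x) := by
  refine (Sym2.map.injective x.injective).comp ?_
  decide

/-- The colour condition. -/
def colQ (g : Fin 5 → Bool) : Prop :=
  g 0 = g 2 ∧ g 0 ≠ g 1 ∧ g 0 ≠ g 3 ∧ g 0 ≠ g 4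

/-- The label condition. -/
def labQ (g : Fin 6 → Fin 6) : Prop :=
  g 0 ≠ 0 ∧ g 1 ≠ 0 ∧ g 2 ≠ 0 ∧ g 3 ≠ 0 ∧ g 4 ≠ 0 ∧ g 5 = 0

theorem card_colQ : (Finset.univ.filter colQ).card = 2 := by
  have : Finset.univ.filter colQ =
      {![true, false, true, false, false], ![false, true, false, true, true]} := by
    ext g
    simp only [colQ, Finset.mem_filter, Finset.mem_univ, true_and, Finset.mem_insert,
      Finset.mem_singleton]
    revert g
    decide
  rw [this]
  rfl

theorem card_labQ : (Finset.univ.filter labQ).card = 3125 := by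
  have : Finset.univ.filter labQ = Fintype.piFinset
      (![{0}ᶜ, {0}ᶜ, {0}ᶜ, {0}ᶜ, {0}ᶜ, {0}] : Fin 6 → Finset (Fin 6)) := by
    ext g
    simp [labQ, Fintype.mem_piFinset, Fin.forall_fin_succ]
  rw [this, Fintype.card_piFinset]
  simp [Fin.prod_univ_succ, Finset.card_compl]

theorem lab_of {n : ℕ} (c : Fin n → Bool) (w : Sym2 (Fin n) → Fin 6) (x : Fin 5 ↪ Fin n)
    (hc : colQ (c ∘ x)) (hw : labQ (w ∘ sixPairs x)) : Lab (ranG c w) x := by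
  obtain ⟨c2, c1, c3, c4⟩ := hc
  obtain ⟨w0, w1, w2, w3, w4, w5⟩ := hw
  simp only [Function.comp_apply, sixPairs] at c2 c1 c3 c4 w0 w1 w2 w3 w4 w5
  simp at w0 w1 w2 w3 w4 w5
  have w0' := w0
  have w1' := w1
  have w2' := w2
  have w3' := w3
  have w4' := w4
  have w5' := w5
  rw [Sym2.eq_swap] at w0' w1' w2' w3' w4' w5'
  have d2 : c (x 2) = c (x 0) := c2.symm
  have d1 : c (x 1) = !c (x 0) := by revert c1; cases c (x 0) <;> cases c (x 1) <;> simp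
  have d3 : c (x 3) = !c (x 0) := by revert c3; cases c (x 0) <;> cases c (x 3) <;> simp
  have d4 : c (x 4) = !c (x 0) := by revert c4; cases c (x 0) <;> cases c (x 4) <;> simp
  intro i j
  rw [adjF_iff]
  fin_cases i <;> fin_cases j <;>
    simp [ranG, adjF, d1, d2, d3, d4, w0, w1, w2, w3, w4, w5, w0', w1', w2', w3', w4', w5']

theorem card_lab_ge {n : ℕ} (x : Fin 5 ↪ Fin n) :
    6250 * Fintype.card ((Fin n → Bool) × (Sym2 (Fin n) → Fin 6)) ≤
    (Finset.univ.filter (fun p : (Fin n → Bool) × (Sym2 (Fin n) → Fin 6) =>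
      Lab (ranG p.1 p.2) x)).card * (2 ^ 5 * 6 ^ 6) := by
  have h1 := cylinder_card (β := Bool) x x.injective colQ
  have h2 := cylinder_card (β := Fin 6) (sixPairs x) (sixPairs_inj x) labQ
  rw [card_colQ, Fintype.card_bool] at h1
  rw [card_labQ, Fintype.card_fin] at h2
  have h3 : ((Finset.univ.filter (fun c : Fin n → Bool => colQ (c ∘ x))) ×ˢ
      (Finset.univ.filter (fun w : Sym2 (Fin n) → Fin 6 => labQ (w ∘ sixPairs x)))).card ≤
      (Finset.univ.filter (fun p : (Fin n → Bool) × (Sym2 (Fin n) → Fin 6) =>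
      Lab (ranG p.1 p.2) x)).card := by
    refine Finset.card_le_card fun p hp => ?_
    simp only [Finset.mem_product, Finset.mem_filter, Finset.mem_univ, true_and] at hp ⊢
    exact lab_of _ _ _ hp.1 hp.2
  rw [Finset.card_product] at h3
  rw [Fintype.card_prod]
  refine le_trans (le_of_eq ?_) (Nat.mul_le_mul_right _ h3)
  calc _ = (2 * Fintype.card (Fin n → Bool)) * (3125 * Fintype.card (Sym2 (Fin n) → Fin 6)) := by
        ring
    _ = _ := by rw [← h1, ← h2]; ring

theorem aut_card : (Finset.univ.filter (fun σ : Equiv.Perm (Fin 5) =>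
    ∀ i j, adjF (σ i) (σ j) = adjF i j)).card = 2 := by
  decide +kernel

theorem card_lab_le {n : ℕ} (G : SimpleGraph (Fin n)) :
    (Finset.univ.filter (fun x : Fin 5 ↪ Fin n => Lab G x)).card ≤
      2 * numCopies fourCyclePendant G := by
  rw [numCopies]
  refine Finset.card_le_mul_card_image_of_maps_to (f := fun x : Fin 5 ↪ Fin n =>
    Finset.univ.map x) ?_ 2 ?_
  · intro x hx
    simp only [Finset.mem_filter, Finset.mem_univ, true_and] at hx
    simp only [Finset.mem_filter, Finset.mem_powersetCard_univ, Finset.card_map, Finset.card_univ,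
      Fintype.card_fin, true_and]
    refine ⟨⟨Equiv.ofBijective (fun i => ⟨x i, by simp⟩) ⟨?_, ?_⟩, ?_⟩⟩
    · intro i j hij
      exact x.injective (congrArg Subtype.val hij)
    · rintro ⟨v, hv⟩
      have hv' : v ∈ Finset.univ.map x := hv
      simp only [Finset.mem_map, Finset.mem_univ, true_and] at hv'
      obtain ⟨i, hi⟩ := hv'
      exact ⟨i, Subtype.ext hi⟩
    · intro i j
      exact hx i j
  · intro S _
    by_cases hne : ((Finset.univ.filter (fun x : Fin 5 ↪ Fin n => Lab G x)).filter
      (fun x => Finset.univ.map x = S)).Nonempty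
    · obtain ⟨x0, hx0⟩ := hne
      simp only [Finset.mem_filter, Finset.mem_univ, true_and] at hx0
      rw [← aut_card]
      refine le_trans (Finset.card_le_card (t := (Finset.univ.filter
        (fun σ : Equiv.Perm (Fin 5) => ∀ i j, adjF (σ i) (σ j) = adjF i j)).image
        (fun σ => σ.toEmbedding.trans x0)) ?_) Finset.card_image_le
      intro x hx
      simp only [Finset.mem_filter, Finset.mem_univ, true_and] at hx
      have hex : ∀ i, ∃ j, x0 j = x i := by
        intro i
        have : x i ∈ Finset.univ.map x0 := by
          rw [hx0.2, ← hx.2]; simp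
        simpa using this
      choose σ hσ using hex
      have hinj : Function.Injective σ := by
        intro i j hij
        apply x.injective
        rw [← hσ, ← hσ, hij]
      simp only [Finset.mem_image, Finset.mem_filter, Finset.mem_univ, true_and]
      refine ⟨Equiv.ofBijective σ (Finite.injective_iff_bijective.1 hinj), ?_, ?_⟩
      · intro i j
        rw [Bool.eq_iff_iff, ← adjF_iff, ← adjF_iff, ← hx.1 i j, ← hσ, ← hσ]
        exact (hx0.1 _ _).symm
      · ext i
        simp [hσ]
    · rw [Finset.not_nonempty_iff_eq_empty] at hne
      rw [hne]
      simp

theorem exists_good {n : ℕ} : ∃ G : SimpleGraph (Fin n),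
    15625 * n.choose 5 ≤ numCopies fourCyclePendant G * 62208 := by
  by_contra! hcon
  let Ω := (Fin n → Bool) × (Sym2 (Fin n) → Fin 6)
  have hpos : 0 < Fintype.card Ω := Fintype.card_pos
  have hdc : ∑ x : Fin 5 ↪ Fin n, (Finset.univ.filter (fun p : Ω => Lab (ranG p.1 p.2) x)).card =
      ∑ p : Ω, (Finset.univ.filter (fun x : Fin 5 ↪ Fin n => Lab (ranG p.1 p.2) x)).card :=
    Finset.sum_card_bipartiteAbove_eq_sum_card_bipartiteBelow
      (fun (x : Fin 5 ↪ Fin n) (p : Ω) => Lab (ranG p.1 p.2) x)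
  have h1 : ∑ x : Fin 5 ↪ Fin n, 6250 * Fintype.card Ω ≤
      (∑ x : Fin 5 ↪ Fin n, (Finset.univ.filter (fun p : Ω => Lab (ranG p.1 p.2) x)).card)
        * (2 ^ 5 * 6 ^ 6) := by
    rw [Finset.sum_mul]
    exact Finset.sum_le_sum fun x _ => card_lab_ge x
  have h2 : ∑ p : Ω, (Finset.univ.filter (fun x : Fin 5 ↪ Fin n => Lab (ranG p.1 p.2) x)).card
      ≤ ∑ p : Ω, 2 * numCopies fourCyclePendant (ranG p.1 p.2) :=
    Finset.sum_le_sum fun p _ => card_lab_le _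
  have h3 : (∑ p : Ω, 2 * numCopies fourCyclePendant (ranG p.1 p.2)) * 31104 <
      Fintype.card Ω * (15625 * n.choose 5) := by
    rw [Finset.sum_mul]
    calc _ < ∑ p : Ω, 15625 * n.choose 5 := by
          refine Finset.sum_lt_sum_of_nonempty ?_ fun p _ => ?_
          · exact Finset.card_pos.1 (by rwa [Finset.card_univ])
          · have := hcon (ranG p.1 p.2)
            linarith
      _ = _ := by simp
  rw [hdc, Finset.sum_const, Finset.card_univ, Fintype.card_embedding_eq, Fintype.card_fin,
    Fintype.card_fin, Nat.descFactorial_eq_factorial_mul_choose, smul_eq_mul] at h1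
  have h5 : Nat.factorial 5 = 120 := rfl
  rw [h5] at h1
  generalize (∑ p : Ω, 2 * numCopies fourCyclePendant (ranG p.1 p.2)) = s2 at *
  generalize (∑ p : Ω, (Finset.univ.filter
    (fun x : Fin 5 ↪ Fin n => Lab (ranG p.1 p.2) x)).card) = s1 at *
  have h6 : 120 * n.choose 5 * (6250 * Fintype.card Ω) =
    48 * (Fintype.card Ω * (15625 * n.choose 5)) := by ring
  rw [h6] at h1
  linarith

theorem lamFmax_bdd (n : ℕ) :
    BddAbove (Set.range fun G : SimpleGraph (Fin n) => lamF fourCyclePendant G) :=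
  (Set.finite_range _).bddAbove

theorem lamFmax_ge {n : ℕ} (hn : 5 ≤ n) : 15625 / 62208 ≤ lamFmax fourCyclePendant n := by
  obtain ⟨G, hG⟩ := exists_good (n := n)
  refine le_trans ?_ (le_ciSup (lamFmax_bdd n) G)
  have hc : (0 : ℝ) < n.choose 5 := by exact_mod_cast Nat.choose_pos hn
  have hG' : (15625 : ℝ) * n.choose 5 ≤ numCopies fourCyclePendant G * 62208 := by
    exact_mod_cast hG
  rw [lamF, div_le_div_iff₀ (by norm_num) hc]
  exact hG'

theorem lamFmax_le {n : ℕ} (hn : 5 ≤ n) :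
    lamFmax fourCyclePendant n ≤ 15625 / 62208 * ((n : ℝ) / (n + (-4))) ^ 5 := by
  refine ciSup_le fun G => ?_
  have hG : (numCopies fourCyclePendant G : ℝ) * 120 * 62208 ≤ 15625 * (n : ℝ) ^ 5 := by
    exact_mod_cast numCopies_le G
  have hc : (0 : ℝ) < n.choose 5 := by exact_mod_cast Nat.choose_pos hn
  have hd : ((n : ℝ) + (-4)) ^ 5 ≤ 120 * n.choose 5 := by
    have h := Nat.pow_sub_le_descFactorial n 5
    rw [Nat.descFactorial_eq_factorial_mul_choose] at h
    have h5 : Nat.factorial 5 = 120 := rfl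
    rw [h5] at h
    have hpow : ((n + 1 - 5 : ℕ) : ℝ) ^ 5 ≤ 120 * n.choose 5 := by exact_mod_cast h
    have he : ((n + 1 - 5 : ℕ) : ℝ) = (n : ℝ) + (-4) := by
      rw [Nat.cast_sub (by omega)]
      push_cast
      ring
    rwa [he] at hpow
  have hp : (0 : ℝ) < (n : ℝ) + (-4) := by
    have : (5 : ℝ) ≤ n := by exact_mod_cast hn
    linarith
  rw [lamF, div_pow, div_mul_div_comm, div_le_div_iff₀ hc (by positivity)]
  have hN : (0 : ℝ) ≤ numCopies fourCyclePendant G := by positivity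
  calc (numCopies fourCyclePendant G : ℝ) * (62208 * ((n : ℝ) + (-4)) ^ 5)
      ≤ (numCopies fourCyclePendant G : ℝ) * (62208 * (120 * n.choose 5)) := by gcongr
    _ = (numCopies fourCyclePendant G : ℝ) * 120 * 62208 * n.choose 5 := by ring
    _ ≤ 15625 * (n : ℝ) ^ 5 * n.choose 5 := by gcongr

theorem inducibility_four_cycle_pendant :
    Filter.Tendsto (fun n => lamFmax fourCyclePendant n) Filter.atTop
      (nhds (15625/62208)) := by
  have h1 : Filter.Tendsto (fun n : ℕ => (15625 / 62208 : ℝ) * ((n : ℝ) / (n + (-4))) ^ 5)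
      Filter.atTop (nhds (15625/62208)) := by
    have h := ((tendsto_natCast_div_add_atTop (-4 : ℝ)).pow 5).const_mul (15625 / 62208 : ℝ)
    simpa using h
  refine tendsto_of_tendsto_of_tendsto_of_le_of_le' tendsto_const_nhds h1 ?_ ?_
  · filter_upwards [Filter.eventually_ge_atTop 5] with n hn
    exact lamFmax_ge hn
  · filter_upwards [Filter.eventually_ge_atTop 5] with n hn
    exact lamFmax_le hn
end

section
/- Let F be the 5-vertex graph with vertex set {0,1,2,3,4} and edge set {01, 12, 23, 30, 04} (the 4-cycle with a pendant edge). For every ε > 0 there is n₀ such that every simple graph G of order n ≥ n₀ with λ_F(G) = λ_F(n) admits a partition V(G) = V₀ ∪ V₁ such that both V₀ and V₁ are independent sets in G and every vertex of G has at least (5/12 − ε)·n and at most (5/12 + ε)·n neighbours in the part not containing it. -/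
open Finset
open scoped Classical

namespace FCP

/-! ### The flag algebra certificate -/

/-- Degree deviation. -/
def gV (a : Bool) : ℤ := cond a 7 (-5)

/-- Tables for the type with no edge. -/
def lE1 (a b c : Bool) : ℤ :=
  cond a (cond b (cond c 4256 (-4105)) (cond c (-4105) 2780))
    (cond b (cond c (-4105) 2780) (cond c 2780 (-1225)))
def lE2 (a b c : Bool) : ℤ :=
  cond a (cond b (cond c 91 235) (cond c 235 (-125)))
    (cond b (cond c 235 (-125)) (-125))

/-- Tables for the type with the one edge `01`. -/
def lD1 (a b c : Bool) : ℤ :=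
  cond a (cond b (cond c 22165691 5464886) (cond c (-43364170) 35594750))
    (cond b (cond c (-43364170) 35594750) (cond c 39752630 (-51496450)))
def lD2 (a b c : Bool) : ℤ :=
  cond a (cond b (cond c 3410495651 4909971206) (cond c 2227529030 (-806230450)))
    (cond b (cond c 2227529030 (-806230450)) (cond c (-4365309370) (-806230450)))
def lD3 (a b c : Bool) : ℤ :=
  cond a (cond b (cond c 19 (-26)) (cond c 70 (-50)))
    (cond c 70 (-50))

/-- Tables for the type which is a path with centre `0`. -/
def lC1 (a b c : Bool) : ℤ :=
  cond a (cond b (cond c 8109697 (-13143152)) (cond c (-13143152) 27603100))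
    (cond b (cond c 12026380 (-42566060)) (cond c (-42566060) (-100441700)))
def lC2 (a b c : Bool) : ℤ :=
  cond a (cond b (cond c (-392137475) 224793664) (cond c 224793664 (-551383100)))
    (cond b (cond c 1397966260 (-1454798180)) (cond c (-1454798180) (-551383100)))
def lC3 (a b c : Bool) : ℤ :=
  cond a (cond b (cond c 41 (-16)) (cond c (-16) (-100)))
    (cond b (cond c 140 20) (cond c 20 (-100)))
def lC4 (a b c : Bool) : ℤ :=
  cond a 0 (cond b (cond c 0 1) (cond c (-1) 0))

def qE (a b c a' b' c' : Bool) : ℤ :=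
  91342413724160006553600 * (lE1 a b c * lE1 a' b' c')
  + 1150938200011323415910400 * (lE2 a b c * lE2 a' b' c')

def qD (a b c a' b' c' : Bool) : ℤ :=
  364626518193457 * (lD1 a b c * lD1 a' b' c')
  + 9556955369 * (lD2 a b c * lD2 a' b' c')
  + 37885605881809673716866774 * (lD3 a b c * lD3 a' b' c')

def qC (a b c a' b' c' : Bool) : ℤ :=
  248005081200408 * (lC1 a b c * lC1 a' b' c')
  + 216776189280 * (lC2 a b c * lC2 a' b' c')
  + 34300134388249655945547528 * (lC3 a b c * lC3 a' b' c')
  + 1503443479561513016268478464000 * (lC4 a b c * lC4 a' b' c')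

/-- The quadratic form for the type with edges `t01 t02 t12`. -/
def qT (t01 t02 t12 a b c a' b' c' : Bool) : ℤ :=
  cond t01
    (cond t02 (cond t12 0 (qC a b c a' b' c'))
      (cond t12 (qC b a c b' a' c') (qD a b c a' b' c')))
    (cond t02 (cond t12 (qC c a b c' a' b') (qD a c b a' c' b'))
      (cond t12 (qD b c a b' c' a') (qE a b c a' b' c')))

def qV (a b c a' b' c' : Bool) : ℤ :=
  137872929100767426558720000 * (gV a * gV a' + gV b * gV b' + gV c * gV c')

/-- number of edges among six. -/
def cnt6 (a b c a' b' c' : Bool) : ℕ :=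
  a.toNat + b.toNat + c.toNat + a'.toNat + b'.toNat + c'.toNat

/-- `K_{2,3}` minus an edge, with three-side the roots. -/
def isI (t01 t02 t12 a b c a' b' c' e : Bool) : Bool :=
  !t01 && !t02 && !t12 && !e && (cnt6 a b c a' b' c' == 5)

def uC : ℤ := 165394588652552095200000000000
def uU : ℤ := 658487460537469487244902400000
def uA : ℤ := 3292437302687347436224512000

def loc (t01 t02 t12 a b c a' b' c' e : Bool) : ℤ :=
  uC - cond (isI t01 t02 t12 a b c a' b' c' e) (10 * uU) 0
    - qT t01 t02 t12 a b c a' b' c' - qV a b c a' b' c'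

def tri (a b c : Bool) : ℤ := cond (a && b && c) 1 0
def cyc (a b c d e : Bool) : ℤ := cond (a && b && c && d && e) 1 0

/-- Symmetrised certificate. -/
def symLoc (b01 b02 b03 b04 b12 b13 b14 b23 b24 b34 : Bool) : ℤ :=
  loc b01 b02 b12 b03 b13 b23 b04 b14 b24 b34
  + loc b01 b03 b13 b02 b12 b23 b04 b14 b34 b24
  + loc b01 b04 b14 b02 b12 b24 b03 b13 b34 b23
  + loc b02 b03 b23 b01 b12 b13 b04 b24 b34 b14
  + loc b02 b04 b24 b01 b12 b14 b03 b23 b34 b13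
  + loc b03 b04 b34 b01 b13 b14 b02 b23 b24 b12
  + loc b12 b13 b23 b01 b02 b03 b14 b24 b34 b04
  + loc b12 b14 b24 b01 b02 b04 b13 b23 b34 b03
  + loc b13 b14 b34 b01 b03 b04 b12 b23 b24 b02
  + loc b23 b24 b34 b02 b03 b04 b12 b13 b14 b01

theorem cert : ∀ b01 b02 b03 b04 b12 b13 b14 b23 b24 b34 : Bool,
    uA * (tri b01 b02 b12 + cyc b01 b12 b23 b34 b04)
      ≤ symLoc b01 b02 b03 b04 b12 b13 b14 b23 b24 b34 := by
  decide +kernel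

end FCP

namespace FCP

/-! ### Weighted sums over five-tuples -/

section weighted

variable {V : Type*} [Fintype V]

/-- Weighted sum over five-tuples. -/
noncomputable def T (w : V → ℝ) (g : (Fin 5 → V) → ℝ) : ℝ :=
  ∑ x : Fin 5 → V, (∏ i, w (x i)) * g x

lemma T_add (w : V → ℝ) (g h : (Fin 5 → V) → ℝ) :
    T w (fun x => g x + h x) = T w g + T w h := by
  simp only [T, mul_add, Finset.sum_add_distrib]

lemma T_sub (w : V → ℝ) (g h : (Fin 5 → V) → ℝ) :
    T w (fun x => g x - h x) = T w g - T w h := by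
  simp only [T, mul_sub, Finset.sum_sub_distrib]

lemma T_mul (w : V → ℝ) (c : ℝ) (g : (Fin 5 → V) → ℝ) :
    T w (fun x => c * g x) = c * T w g := by
  simp only [T, Finset.mul_sum]
  refine Finset.sum_congr rfl fun x _ => ?_
  ring

lemma T_mono (w : V → ℝ) (hw : ∀ v, 0 ≤ w v) (g h : (Fin 5 → V) → ℝ) (hgh : ∀ x, g x ≤ h x) :
    T w g ≤ T w h := by
  refine Finset.sum_le_sum fun x _ => ?_
  exact mul_le_mul_of_nonneg_left (hgh x) (Finset.prod_nonneg fun i _ => hw _)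

lemma T_perm (w : V → ℝ) (g : (Fin 5 → V) → ℝ) (σ : Equiv.Perm (Fin 5)) :
    T w (fun x => g (x ∘ σ)) = T w g := by
  unfold T
  refine Fintype.sum_equiv (Equiv.arrowCongr σ.symm (Equiv.refl V)) _ _ fun x => ?_
  have h1 : (Equiv.arrowCongr σ.symm (Equiv.refl V)) x = x ∘ σ := by
    ext i; simp [Equiv.arrowCongr]
  rw [h1]
  congr 1
  exact (Equiv.prod_comp σ (fun i => w (x i))).symm

lemma sum_cons {k : ℕ} (f : (Fin (k + 1) → V) → ℝ) :
    ∑ x, f x = ∑ a : V, ∑ y : Fin k → V, f (Matrix.vecCons a y) := by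
  rw [← Fintype.sum_prod_type']
  exact (Fintype.sum_equiv (Fin.consEquiv (fun _ => V)) _ _ fun x => rfl).symm

lemma sum_nil (f : (Fin 0 → V) → ℝ) : ∑ x, f x = f ![] := by
  rw [Fintype.sum_eq_single ![]]
  intro x hx
  exact absurd (Subsingleton.elim _ _) hx

lemma T_eq (w : V → ℝ) (g : (Fin 5 → V) → ℝ) :
    T w g = ∑ p, ∑ q, ∑ r, ∑ y, ∑ z, w p * w q * w r * (w y * w z * g ![p, q, r, y, z]) := by
  unfold T
  simp only [sum_cons, sum_nil]
  refine Finset.sum_congr rfl fun p _ => Finset.sum_congr rfl fun q _ =>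
    Finset.sum_congr rfl fun r _ => Finset.sum_congr rfl fun y _ =>
    Finset.sum_congr rfl fun z _ => ?_
  simp [Fin.prod_univ_succ]
  ring

lemma T_const (w : V → ℝ) (c : ℝ) : T w (fun _ => c) = (∑ v, w v) ^ 5 * c := by
  rw [T_eq]
  simp only [← Finset.mul_sum, ← Finset.sum_mul]
  ring

variable (b : V → V → Bool)

/-- local function evaluated at a tuple. -/
def locX (x : Fin 5 → V) : ℤ :=
  loc (b (x 0) (x 1)) (b (x 0) (x 2)) (b (x 1) (x 2)) (b (x 0) (x 3)) (b (x 1) (x 3))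
    (b (x 2) (x 3)) (b (x 0) (x 4)) (b (x 1) (x 4)) (b (x 2) (x 4)) (b (x 3) (x 4))

def isX (x : Fin 5 → V) : Bool :=
  isI (b (x 0) (x 1)) (b (x 0) (x 2)) (b (x 1) (x 2)) (b (x 0) (x 3)) (b (x 1) (x 3))
    (b (x 2) (x 3)) (b (x 0) (x 4)) (b (x 1) (x 4)) (b (x 2) (x 4)) (b (x 3) (x 4))

def qTX (x : Fin 5 → V) : ℤ :=
  qT (b (x 0) (x 1)) (b (x 0) (x 2)) (b (x 1) (x 2)) (b (x 0) (x 3)) (b (x 1) (x 3))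
    (b (x 2) (x 3)) (b (x 0) (x 4)) (b (x 1) (x 4)) (b (x 2) (x 4))

def qVX (x : Fin 5 → V) : ℤ :=
  qV (b (x 0) (x 3)) (b (x 1) (x 3))
    (b (x 2) (x 3)) (b (x 0) (x 4)) (b (x 1) (x 4)) (b (x 2) (x 4))

/-- triangle indicator on the first three coordinates. -/
def triX (x : Fin 5 → V) : ℤ := tri (b (x 0) (x 1)) (b (x 0) (x 2)) (b (x 1) (x 2))

/-- five-cycle indicator. -/
def cycX (x : Fin 5 → V) : ℤ :=
  cyc (b (x 0) (x 1)) (b (x 1) (x 2)) (b (x 2) (x 3)) (b (x 3) (x 4)) (b (x 0) (x 4))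

/-- labelled induced copy of the four-cycle with a pendant edge. -/
def f0B (b01 b02 b03 b04 b12 b13 b14 b23 b24 b34 : Bool) : ℤ :=
  cond (b01 && b12 && b23 && b03 && b04 && !b02 && !b13 && !b14 && !b24 && !b34) 1 0

def f0X (x : Fin 5 → V) : ℤ :=
  f0B (b (x 0) (x 1)) (b (x 0) (x 2)) (b (x 0) (x 3)) (b (x 0) (x 4)) (b (x 1) (x 2))
    (b (x 1) (x 3)) (b (x 1) (x 4)) (b (x 2) (x 3)) (b (x 2) (x 4)) (b (x 3) (x 4))

/-- permutation of `Fin 5` from a list of values, with its inverse -/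
def mkP (f g : Fin 5 → Fin 5) (h : ∀ i, g (f i) = i) (h' : ∀ i, f (g i) = i) :
    Equiv.Perm (Fin 5) := ⟨f, g, h, h'⟩

def s1 : Equiv.Perm (Fin 5) := mkP ![0,1,3,2,4] ![0,1,3,2,4] (by decide) (by decide)
def s2 : Equiv.Perm (Fin 5) := mkP ![0,1,4,2,3] ![0,1,3,4,2] (by decide) (by decide)
def s3 : Equiv.Perm (Fin 5) := mkP ![0,2,3,1,4] ![0,3,1,2,4] (by decide) (by decide)
def s4 : Equiv.Perm (Fin 5) := mkP ![0,2,4,1,3] ![0,3,1,4,2] (by decide) (by decide)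
def s5 : Equiv.Perm (Fin 5) := mkP ![0,3,4,1,2] ![0,3,4,1,2] (by decide) (by decide)
def s6 : Equiv.Perm (Fin 5) := mkP ![1,2,3,0,4] ![3,0,1,2,4] (by decide) (by decide)
def s7 : Equiv.Perm (Fin 5) := mkP ![1,2,4,0,3] ![3,0,1,4,2] (by decide) (by decide)
def s8 : Equiv.Perm (Fin 5) := mkP ![1,3,4,0,2] ![3,0,4,1,2] (by decide) (by decide)
def s9 : Equiv.Perm (Fin 5) := mkP ![2,3,4,0,1] ![3,4,0,1,2] (by decide) (by decide)

lemma T_loc_ge (w : V → ℝ) (hw : ∀ v, 0 ≤ w v) (hb : ∀ u v, b u v = b v u) :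
    uA * (T w (fun x => (triX b x : ℝ)) + T w (fun x => (cycX b x : ℝ)))
      ≤ 10 * T w (fun x => (locX b x : ℝ)) := by
  have h : 10 * T w (fun x => (locX b x : ℝ)) =
      T w (fun x => ((locX b x + locX b (x ∘ s1) + locX b (x ∘ s2) + locX b (x ∘ s3)
        + locX b (x ∘ s4) + locX b (x ∘ s5) + locX b (x ∘ s6) + locX b (x ∘ s7)
        + locX b (x ∘ s8) + locX b (x ∘ s9) : ℤ) : ℝ)) := by
    push_cast
    have hp := T_perm w (fun x => (locX b x : ℝ))
    rw [T_add, T_add, T_add, T_add, T_add, T_add, T_add, T_add, T_add, hp, hp, hp, hp, hp, hp,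
      hp, hp, hp]
    ring
  rw [h, ← T_add, ← T_mul]
  refine T_mono w hw _ _ fun x => ?_
  have hc := cert (b (x 0) (x 1)) (b (x 0) (x 2)) (b (x 0) (x 3)) (b (x 0) (x 4)) (b (x 1) (x 2))
    (b (x 1) (x 3)) (b (x 1) (x 4)) (b (x 2) (x 3)) (b (x 2) (x 4)) (b (x 3) (x 4))
  have e : symLoc (b (x 0) (x 1)) (b (x 0) (x 2)) (b (x 0) (x 3)) (b (x 0) (x 4)) (b (x 1) (x 2))
    (b (x 1) (x 3)) (b (x 1) (x 4)) (b (x 2) (x 3)) (b (x 2) (x 4)) (b (x 3) (x 4)) =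
      (locX b x + locX b (x ∘ s1) + locX b (x ∘ s2) + locX b (x ∘ s3)
        + locX b (x ∘ s4) + locX b (x ∘ s5) + locX b (x ∘ s6) + locX b (x ∘ s7)
        + locX b (x ∘ s8) + locX b (x ∘ s9) : ℤ) := by
    simp only [symLoc, locX, s1, s2, s3, s4, s5, s6, s7, s8, s9, mkP, Function.comp,
      Equiv.coe_fn_mk, Matrix.cons_val]
    rw [hb (x 2) (x 1), hb (x 3) (x 1), hb (x 3) (x 2), hb (x 4) (x 1), hb (x 4) (x 2),
      hb (x 4) (x 3), hb (x 1) (x 0), hb (x 2) (x 0), hb (x 3) (x 0), hb (x 4) (x 0)]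
  rw [e] at hc
  exact_mod_cast hc

def t1 : Equiv.Perm (Fin 5) := mkP ![3,1,4,2,0] ![4,1,3,0,2] (by decide) (by decide)
def t2 : Equiv.Perm (Fin 5) := mkP ![3,0,4,2,1] ![1,4,3,0,2] (by decide) (by decide)
def t3 : Equiv.Perm (Fin 5) := mkP ![3,0,4,1,2] ![1,3,4,0,2] (by decide) (by decide)
def t4 : Equiv.Perm (Fin 5) := mkP ![4,1,3,2,0] ![4,1,3,2,0] (by decide) (by decide)
def t5 : Equiv.Perm (Fin 5) := mkP ![4,0,3,2,1] ![1,4,3,2,0] (by decide) (by decide)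
def t6 : Equiv.Perm (Fin 5) := mkP ![4,0,3,1,2] ![1,3,4,2,0] (by decide) (by decide)

lemma isI_f0 : ∀ b01 b02 b03 b04 b12 b13 b14 b23 b24 b34 : Bool,
    cond (isI b01 b02 b12 b03 b13 b23 b04 b14 b24 b34) (1:ℤ) 0 =
      f0B b13 b34 b23 b03 b14 b12 b01 b24 b04 b02
      + f0B b03 b34 b23 b13 b04 b02 b01 b24 b14 b12
      + f0B b03 b34 b13 b23 b04 b01 b02 b14 b24 b12
      + f0B b14 b34 b24 b04 b13 b12 b01 b23 b03 b02
      + f0B b04 b34 b24 b14 b03 b02 b01 b23 b13 b12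
      + f0B b04 b34 b14 b24 b03 b01 b02 b13 b23 b12 := by
  decide +kernel

lemma T_isX (w : V → ℝ) (hb : ∀ u v, b u v = b v u) :
    T w (fun x => ((cond (isX b x) (1:ℤ) 0 : ℤ) : ℝ)) = 6 * T w (fun x => (f0X b x : ℝ)) := by
  have h : 6 * T w (fun x => (f0X b x : ℝ)) =
      T w (fun x => ((f0X b (x ∘ t1) + f0X b (x ∘ t2) + f0X b (x ∘ t3)
        + f0X b (x ∘ t4) + f0X b (x ∘ t5) + f0X b (x ∘ t6) : ℤ) : ℝ)) := by
    push_cast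
    have hp := T_perm w (fun x => (f0X b x : ℝ))
    rw [T_add, T_add, T_add, T_add, T_add, hp, hp, hp, hp, hp, hp]
    ring
  rw [h]
  congr 1
  funext x
  congr 1
  have hc := isI_f0 (b (x 0) (x 1)) (b (x 0) (x 2)) (b (x 0) (x 3)) (b (x 0) (x 4))
    (b (x 1) (x 2)) (b (x 1) (x 3)) (b (x 1) (x 4)) (b (x 2) (x 3)) (b (x 2) (x 4)) (b (x 3) (x 4))
  rw [isX, hc]
  simp only [f0X, t1, t2, t3, t4, t5, t6, mkP, Function.comp,
      Equiv.coe_fn_mk, Matrix.cons_val]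
  rw [hb (x 2) (x 1), hb (x 3) (x 1), hb (x 3) (x 2), hb (x 4) (x 1), hb (x 4) (x 2),
      hb (x 4) (x 3), hb (x 1) (x 0), hb (x 2) (x 0), hb (x 3) (x 0), hb (x 4) (x 0)]

/-- sum of a product kernel is a square -/
lemma sum_sq (w : V → ℝ) (l : V → ℝ) :
    ∑ y, ∑ z, w y * w z * (l y * l z) = (∑ y, w y * l y) ^ 2 := by
  rw [sq, Finset.sum_mul_sum]
  refine Finset.sum_congr rfl fun y _ => Finset.sum_congr rfl fun z _ => ?_
  ring

lemma qE_nonneg (w : V → ℝ) (α β γ : V → Bool) :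
    0 ≤ ∑ y, ∑ z, w y * w z * (qE (α y) (β y) (γ y) (α z) (β z) (γ z) : ℝ) := by
  have e : ∀ y z, w y * w z * (qE (α y) (β y) (γ y) (α z) (β z) (γ z) : ℝ) =
     91342413724160006553600 *
        (w y * w z * ((lE1 (α y) (β y) (γ y) : ℝ) * lE1 (α z) (β z) (γ z))) +
     1150938200011323415910400 *
        (w y * w z * ((lE2 (α y) (β y) (γ y) : ℝ) * lE2 (α z) (β z) (γ z))) := by
    intro y z
    rw [qE]; push_cast; ring
  simp only [e, Finset.sum_add_distrib, ← Finset.mul_sum]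
  rw [sum_sq w (fun y => (lE1 (α y) (β y) (γ y) : ℝ)),
    sum_sq w (fun y => (lE2 (α y) (β y) (γ y) : ℝ))]
  positivity

lemma qD_nonneg (w : V → ℝ) (α β γ : V → Bool) :
    0 ≤ ∑ y, ∑ z, w y * w z * (qD (α y) (β y) (γ y) (α z) (β z) (γ z) : ℝ) := by
  have e : ∀ y z, w y * w z * (qD (α y) (β y) (γ y) (α z) (β z) (γ z) : ℝ) =
     364626518193457 *
        (w y * w z * ((lD1 (α y) (β y) (γ y) : ℝ) * lD1 (α z) (β z) (γ z))) +
     9556955369 *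
        (w y * w z * ((lD2 (α y) (β y) (γ y) : ℝ) * lD2 (α z) (β z) (γ z))) +
     37885605881809673716866774 *
        (w y * w z * ((lD3 (α y) (β y) (γ y) : ℝ) * lD3 (α z) (β z) (γ z))) := by
    intro y z
    rw [qD]; push_cast; ring
  simp only [e, Finset.sum_add_distrib, ← Finset.mul_sum]
  rw [sum_sq w (fun y => (lD1 (α y) (β y) (γ y) : ℝ)),
    sum_sq w (fun y => (lD2 (α y) (β y) (γ y) : ℝ)),
    sum_sq w (fun y => (lD3 (α y) (β y) (γ y) : ℝ))]
  positivity

lemma qC_nonneg (w : V → ℝ) (α β γ : V → Bool) :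
    0 ≤ ∑ y, ∑ z, w y * w z * (qC (α y) (β y) (γ y) (α z) (β z) (γ z) : ℝ) := by
  have e : ∀ y z, w y * w z * (qC (α y) (β y) (γ y) (α z) (β z) (γ z) : ℝ) =
     248005081200408 *
        (w y * w z * ((lC1 (α y) (β y) (γ y) : ℝ) * lC1 (α z) (β z) (γ z))) +
     216776189280 *
        (w y * w z * ((lC2 (α y) (β y) (γ y) : ℝ) * lC2 (α z) (β z) (γ z))) +
     34300134388249655945547528 *
        (w y * w z * ((lC3 (α y) (β y) (γ y) : ℝ) * lC3 (α z) (β z) (γ z))) +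
     1503443479561513016268478464000 *
        (w y * w z * ((lC4 (α y) (β y) (γ y) : ℝ) * lC4 (α z) (β z) (γ z))) := by
    intro y z
    rw [qC]; push_cast; ring
  simp only [e, Finset.sum_add_distrib, ← Finset.mul_sum]
  rw [sum_sq w (fun y => (lC1 (α y) (β y) (γ y) : ℝ)),
    sum_sq w (fun y => (lC2 (α y) (β y) (γ y) : ℝ)),
    sum_sq w (fun y => (lC3 (α y) (β y) (γ y) : ℝ)),
    sum_sq w (fun y => (lC4 (α y) (β y) (γ y) : ℝ))]
  positivity

lemma qT_nonneg (w : V → ℝ) (t t' t'' : Bool) (α β γ : V → Bool) :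
    0 ≤ ∑ y, ∑ z, w y * w z * (qT t t' t'' (α y) (β y) (γ y) (α z) (β z) (γ z) : ℝ) := by
  cases t <;> cases t' <;> cases t'' <;> simp only [qT, cond_true, cond_false]
  · exact qE_nonneg w α β γ
  · exact qD_nonneg w β γ α
  · exact qD_nonneg w α γ β
  · exact qC_nonneg w γ α β
  · exact qD_nonneg w α β γ
  · exact qC_nonneg w β α γ
  · exact qC_nonneg w α β γ
  · simp

lemma T_qTX_nonneg (w : V → ℝ) (hw : ∀ v, 0 ≤ w v) : 0 ≤ T w (fun x => (qTX b x : ℝ)) := by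
  rw [T_eq]
  refine Finset.sum_nonneg fun p _ => Finset.sum_nonneg fun q _ => Finset.sum_nonneg fun r _ => ?_
  simp only [← Finset.mul_sum]
  refine mul_nonneg (mul_nonneg (mul_nonneg (hw _) (hw _)) (hw _)) ?_
  exact qT_nonneg w (b p q) (b p r) (b q r) (b p) (b q) (b r)

lemma T_qVX (w : V → ℝ) : T w (fun x => (qVX b x : ℝ)) =
    3 * 137872929100767426558720000 * ((∑ v, w v) ^ 2 *
      ∑ r, w r * (∑ y, w y * (gV (b r y) : ℝ)) ^ 2) := by
  rw [T_eq]
  have e : ∀ p q r, ∑ y, ∑ z, w p * w q * w r * (w y * w z * (qVX b ![p, q, r, y, z] : ℝ)) =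
      137872929100767426558720000 * (
      (w p * (∑ y, w y * (gV (b p y) : ℝ)) ^ 2) * w q * w r
      + w p * (w q * (∑ y, w y * (gV (b q y) : ℝ)) ^ 2) * w r
      + w p * w q * (w r * (∑ y, w y * (gV (b r y) : ℝ)) ^ 2)) := by
    intro p q r
    rw [← sum_sq, ← sum_sq, ← sum_sq]
    have e2 : ∀ y z, w p * w q * w r * (w y * w z * (qVX b ![p, q, r, y, z] : ℝ)) =
      137872929100767426558720000 * (w p * w q * w r) *
        (w y * w z * ((gV (b p y) : ℝ) * gV (b p z)))
      + 137872929100767426558720000 * (w p * w q * w r) *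
        (w y * w z * ((gV (b q y) : ℝ) * gV (b q z)))
      + 137872929100767426558720000 * (w p * w q * w r) *
        (w y * w z * ((gV (b r y) : ℝ) * gV (b r z))) := by
      intro y z
      simp only [qVX, qV, Matrix.cons_val]
      push_cast
      ring
    simp only [e2, Finset.sum_add_distrib, ← Finset.mul_sum]
    ring
  simp only [e]
  generalize hh : (fun p => w p * (∑ y, w y * (gV (b p y) : ℝ)) ^ 2) = h
  have hh2 : ∀ p, w p * (∑ y, w y * (gV (b p y) : ℝ)) ^ 2 = h p := fun p => congrFun hh p
  simp only [hh2, ← Finset.mul_sum, Finset.sum_add_distrib, ← Finset.sum_mul]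
  ring

/-- The main weighted inequality. -/
theorem weighted (w : V → ℝ) (hw : ∀ v, 0 ≤ w v) (hb : ∀ u v, b u v = b v u) :
    60 * T w (fun x => (f0X b x : ℝ)) + (1 / 2000) *
      (T w (fun x => (triX b x : ℝ)) + T w (fun x => (cycX b x : ℝ))
        + (∑ v, w v) ^ 2 * ∑ r, w r * (∑ y, w y * (gV (b r y) : ℝ)) ^ 2)
      ≤ 15625 / 62208 * (∑ v, w v) ^ 5 := by
  have h1 := T_loc_ge b w hw hb
  have h2 : T w (fun x => (locX b x : ℝ)) =
      (∑ v, w v) ^ 5 * uC - 10 * uU * (6 * T w (fun x => (f0X b x : ℝ)))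
        - T w (fun x => (qTX b x : ℝ)) - T w (fun x => (qVX b x : ℝ)) := by
    rw [← T_isX b w hb, ← T_const, ← T_mul, ← T_sub, ← T_sub, ← T_sub]
    congr 1
    funext x
    have : locX b x = uC - 10 * uU * (cond (isX b x) (1:ℤ) 0) - qTX b x - qVX b x := by
      unfold locX loc isX qTX qVX
      cases isI (b (x 0) (x 1)) (b (x 0) (x 2)) (b (x 1) (x 2)) (b (x 0) (x 3)) (b (x 1) (x 3))
        (b (x 2) (x 3)) (b (x 0) (x 4)) (b (x 1) (x 4)) (b (x 2) (x 4)) (b (x 3) (x 4)) <;> simp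
    rw [this]; push_cast; ring
  have h3 := T_qTX_nonneg b w hw
  have h4 := T_qVX b w
  have h5 : 0 ≤ (∑ v, w v) ^ 2 * ∑ r, w r * (∑ y, w y * (gV (b r y) : ℝ)) ^ 2 :=
    mul_nonneg (sq_nonneg _) (Finset.sum_nonneg fun r _ => mul_nonneg (hw r) (sq_nonneg _))
  rw [h2, h4] at h1
  simp only [uA, uC, uU] at h1
  push_cast at h1
  linarith

end weighted

end FCP

namespace FCP

/-! ### Labelled copies -/

section emb

variable {V : Type*}

/-- labelled induced copies of the four-cycle with a pendant edge -/
def good (G : SimpleGraph V) (x : Fin 5 → V) : Prop :=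
  G.Adj (x 0) (x 1) ∧ G.Adj (x 1) (x 2) ∧ G.Adj (x 2) (x 3) ∧ G.Adj (x 0) (x 3) ∧
  G.Adj (x 0) (x 4) ∧ ¬ G.Adj (x 0) (x 2) ∧ ¬ G.Adj (x 1) (x 3) ∧ ¬ G.Adj (x 1) (x 4) ∧
  ¬ G.Adj (x 2) (x 4) ∧ ¬ G.Adj (x 3) (x 4) ∧ x 1 ≠ x 3

def aF (i j : Fin 5) : Bool :=
  (i == 0 && j == 1) || (i == 1 && j == 2) || (i == 2 && j == 3) || (i == 0 && j == 3)
  || (i == 0 && j == 4) ||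
  (j == 0 && i == 1) || (j == 1 && i == 2) || (j == 2 && i == 3) || (j == 0 && i == 3)
  || (j == 0 && i == 4)

lemma F_adj (i j : Fin 5) : fourCyclePendant.Adj i j ↔ aF i j = true := by
  simp only [fourCyclePendant, SimpleGraph.fromRel_adj]
  revert i j
  decide

lemma good_adj {G : SimpleGraph V} {x : Fin 5 → V} (h : good G x) (i j : Fin 5) :
    G.Adj (x i) (x j) ↔ aF i j = true := by
  obtain ⟨h1, h2, h3, h4, h5, h6, h7, h8, h9, h10, -⟩ := h
  fin_cases i <;> fin_cases j <;> simp [aF, *, G.adj_comm] <;>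
    first
    | exact h1 | exact h2 | exact h3 | exact h4 | exact h5 | exact h6 | exact h7 | exact h8
    | exact h9 | exact h10
    | exact h1.symm | exact h2.symm | exact h3.symm | exact h4.symm | exact h5.symm
    | exact fun h => h6 h.symm | exact fun h => h7 h.symm | exact fun h => h8 h.symm
    | exact fun h => h9 h.symm | exact fun h => h10 h.symm

lemma good_inj {G : SimpleGraph V} {x : Fin 5 → V} (h : good G x) : Function.Injective x := by
  intro i j hij
  by_contra hne
  have key : ∀ k, aF i k = aF j k := by
    intro k
    have h1 := good_adj h i k
    rw [hij, good_adj h j k] at h1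
    exact (Bool.eq_iff_iff.2 h1).symm
  have : ∀ i j : Fin 5, i ≠ j → (∀ k, aF i k = aF j k) → (i = 1 ∧ j = 3) ∨ (i = 3 ∧ j = 1) := by
    decide
  rcases this i j hne key with ⟨rfl, rfl⟩ | ⟨rfl, rfl⟩
  · exact h.2.2.2.2.2.2.2.2.2.2 hij
  · exact h.2.2.2.2.2.2.2.2.2.2 hij.symm

lemma good_of_adj {G : SimpleGraph V} {x : Fin 5 → V} (hi : Function.Injective x)
    (h : ∀ i j, G.Adj (x i) (x j) ↔ aF i j = true) : good G x := by
  refine ⟨(h _ _).2 ?_, (h _ _).2 ?_, (h _ _).2 ?_, (h _ _).2 ?_, (h _ _).2 ?_, ?_, ?_, ?_, ?_,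
    ?_, ?_⟩
  all_goals first | (rw [h]; decide) | skip
  any_goals decide
  exact fun h => absurd (hi h) (by decide)

lemma aut_F : ∀ a b c d e : Fin 5, a ≠ b → a ≠ c → a ≠ d → a ≠ e → b ≠ c → b ≠ d → b ≠ e →
    c ≠ d → c ≠ e → d ≠ e → aF a b = true → aF b c = true → aF c d = true → aF a d = true →
    aF a e = true → aF a c = false →
    (a = 0 ∧ c = 2 ∧ e = 4 ∧ ((b = 1 ∧ d = 3) ∨ (b = 3 ∧ d = 1))) := by
  set_option synthInstance.maxSize 10000 in
  set_option synthInstance.maxHeartbeats 200000 in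
  set_option maxSynthPendingDepth 100 in
  decide +kernel

variable [Fintype V]

/-- set of labelled copies -/
noncomputable def E (G : SimpleGraph V) : Finset (Fin 5 → V) :=
  Finset.univ.filter (fun x => good G x)

lemma mem_E {G : SimpleGraph V} {x : Fin 5 → V} : x ∈ E G ↔ good G x := by
  simp [E]

def sw : Equiv.Perm (Fin 5) := mkP ![0,3,2,1,4] ![0,3,2,1,4] (by decide) (by decide)

lemma good_sw {G : SimpleGraph V} {x : Fin 5 → V} (h : good G x) : good G (x ∘ sw) := by
  refine good_of_adj ((good_inj h).comp sw.injective) ?_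
  intro i j
  rw [Function.comp, Function.comp, good_adj h]
  have : ∀ i j, aF (sw i) (sw j) = aF i j := by decide
  rw [this]

lemma good_same_image [DecidableEq V] {G : SimpleGraph V} {x y : Fin 5 → V} (hx : good G x) (hy : good G y)
    (h : Finset.univ.image y = Finset.univ.image x) : y = x ∨ y = x ∘ sw := by
  have : ∀ i, ∃ j, x j = y i := by
    intro i
    have : y i ∈ Finset.univ.image x := by rw [← h]; exact Finset.mem_image_of_mem _ (mem_univ _)
    simpa using this
  choose σ hσ using this
  have hinj : ∀ i j, i ≠ j → σ i ≠ σ j := by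
    intro i j hij he
    apply hij
    apply good_inj hy
    rw [← hσ, ← hσ, he]
  have hadj : ∀ i j, aF (σ i) (σ j) = aF i j := by
    intro i j
    have h1 := good_adj hx (σ i) (σ j)
    rw [hσ, hσ, good_adj hy] at h1
    exact (Bool.eq_iff_iff.2 h1).symm
  have := aut_F (σ 0) (σ 1) (σ 2) (σ 3) (σ 4) (hinj _ _ (by decide)) (hinj _ _ (by decide))
    (hinj _ _ (by decide)) (hinj _ _ (by decide)) (hinj _ _ (by decide)) (hinj _ _ (by decide))
    (hinj _ _ (by decide)) (hinj _ _ (by decide)) (hinj _ _ (by decide)) (hinj _ _ (by decide))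
    ((hadj _ _).trans (by decide)) ((hadj _ _).trans (by decide)) ((hadj _ _).trans (by decide))
    ((hadj _ _).trans (by decide)) ((hadj _ _).trans (by decide)) ((hadj _ _).trans (by decide))
  obtain ⟨h0, h2, h4, h13⟩ := this
  rcases h13 with ⟨h1, h3⟩ | ⟨h1, h3⟩
  · left
    funext i
    rw [← hσ]
    fin_cases i <;> simp [h0, h1, h2, h3, h4]
  · right
    funext i
    rw [← hσ]
    fin_cases i <;> simp [h0, h1, h2, h3, h4, sw, mkP]

lemma good_image_card [DecidableEq V] {G : SimpleGraph V} {x : Fin 5 → V} (h : good G x) :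
    (Finset.univ.image x).card = 5 := by
  rw [Finset.card_image_of_injective _ (good_inj h)]; simp

end emb

lemma copy_iff {n : ℕ} (G : SimpleGraph (Fin n)) (S : Finset (Fin n)) :
    Nonempty (fourCyclePendant ≃g (G.induce (S : Set (Fin n)))) ↔
      ∃ x, good G x ∧ Finset.univ.image x = S := by
  constructor
  · rintro ⟨φ⟩
    refine ⟨fun i => (φ i : Fin n), good_of_adj ?_ ?_, ?_⟩
    · exact Subtype.val_injective.comp φ.injective
    · intro i j
      rw [← F_adj, ← φ.map_adj_iff]
      rfl
    · ext v
      simp only [Finset.mem_image, Finset.mem_univ, true_and]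
      constructor
      · rintro ⟨i, rfl⟩
        exact (φ i).2
      · intro hv
        obtain ⟨i, hi⟩ := φ.surjective ⟨v, hv⟩
        exact ⟨i, by rw [hi]⟩
  · rintro ⟨x, hx, rfl⟩
    refine ⟨⟨Equiv.ofBijective
      (fun i => (⟨x i, by simp⟩ : ((Finset.univ.image x : Finset (Fin n)) : Set (Fin n)))) ?_, ?_⟩⟩
    · constructor
      · intro i j hij
        exact good_inj hx (congrArg Subtype.val hij)
      · rintro ⟨v, hv⟩
        have hv2 := hv
        simp only [Finset.coe_image, Finset.coe_univ, Set.image_univ, Set.mem_range] at hv2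
        obtain ⟨i, hi⟩ := hv2
        exact ⟨i, Subtype.ext hi⟩
    · intro i j
      rw [F_adj]
      exact good_adj hx i j

lemma card_E {n : ℕ} (G : SimpleGraph (Fin n)) :
    (E G).card = 2 * numCopies fourCyclePendant G := by
  unfold numCopies
  rw [Finset.card_eq_sum_card_fiberwise (f := fun x => Finset.univ.image x)
    (t := (Finset.powersetCard 5 Finset.univ).filter
    (fun S : Finset (Fin n) => Nonempty (fourCyclePendant ≃g (G.induce (S : Set (Fin n))))))]
  · rw [Finset.sum_const_nat (m := 2), mul_comm]
    intro S hS
    rw [Finset.mem_filter, copy_iff] at hS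
    obtain ⟨-, x, hx, rfl⟩ := hS
    rw [Finset.card_eq_two]
    refine ⟨x, x ∘ sw, ?_, ?_⟩
    · intro h
      have := congrFun h 1
      exact absurd (good_inj hx this) (by decide)
    · ext y
      simp only [Finset.mem_filter, mem_E, Finset.mem_insert, Finset.mem_singleton]
      constructor
      · rintro ⟨hy, h⟩
        exact good_same_image hx hy h
      · rintro (rfl | rfl)
        · exact ⟨hx, rfl⟩
        · refine ⟨good_sw hx, ?_⟩
          ext v
          simp only [Finset.mem_image, Finset.mem_univ, true_and, Function.comp]
          exact (sw.surjective.exists (p := fun a => x a = v)).symm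
  · intro x hx
    rw [Finset.mem_coe, mem_E] at hx
    rw [Finset.mem_coe, Finset.mem_filter, copy_iff, Finset.mem_powersetCard]
    exact ⟨⟨Finset.subset_univ _, by convert good_image_card hx⟩, x, hx, rfl⟩

lemma extremal_E {n : ℕ} (hn : 5 ≤ n) (G : SimpleGraph (Fin n))
    (h : lamF fourCyclePendant G = lamFmax fourCyclePendant n) (G' : SimpleGraph (Fin n)) :
    (E G').card ≤ (E G).card := by
  have h1 : lamF fourCyclePendant G' ≤ lamF fourCyclePendant G := by
    rw [h]
    exact le_ciSup (Set.finite_range _).bddAbove G'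
  unfold lamF at h1
  have hc : (0:ℝ) < (n.choose 5 : ℝ) := by exact_mod_cast Nat.choose_pos hn
  rw [div_le_div_iff_of_pos_right hc] at h1
  rw [card_E, card_E]
  have : numCopies fourCyclePendant G' ≤ numCopies fourCyclePendant G := by exact_mod_cast h1
  omega

end FCP

namespace FCP

/-! ### Random bipartite graph -/

lemma card_eq_coord {n : ℕ} (i j : Fin 5) (hij : i ≠ j) :
    (Finset.univ.filter (fun x : Fin 5 → Fin n => x i = x j)).card ≤ n ^ 4 := by
  have h : Fintype.card ({k : Fin 5 // k ≠ j} → Fin n) = n ^ 4 := by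
    simp [Fintype.card_subtype_compl]
  rw [← h, ← Finset.card_univ]
  refine Finset.card_le_card_of_injOn (fun x k => x k) (fun _ _ => by simp) ?_
  intro x hx y hy hxy
  simp only [Finset.coe_filter, Finset.mem_univ, true_and, Set.mem_ofPred_eq] at hx hy
  funext k
  by_cases hk : k = j
  · subst hk
    rw [← hx, ← hy]
    exact congrFun hxy ⟨i, hij⟩
  · exact congrFun hxy ⟨k, hk⟩

lemma card_not_inj {n : ℕ} :
    (Finset.univ.filter (fun x : Fin 5 → Fin n => ¬ Function.Injective x)).card ≤ 25 * n ^ 4 := by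
  have hsub : (Finset.univ.filter (fun x : Fin 5 → Fin n => ¬ Function.Injective x)) ⊆
      (Finset.univ.filter (fun p : Fin 5 × Fin 5 => p.1 ≠ p.2)).biUnion
        (fun p => Finset.univ.filter (fun x : Fin 5 → Fin n => x p.1 = x p.2)) := by
    intro x hx
    rw [Finset.mem_filter] at hx
    have hx2 := hx.2
    rw [Function.Injective] at hx2
    push Not at hx2
    obtain ⟨i, j, h1, h2⟩ := hx2
    simp only [Finset.mem_biUnion, Finset.mem_filter, Finset.mem_univ, true_and]
    exact ⟨(i, j), h2, h1⟩
  refine (Finset.card_le_card hsub).trans (Finset.card_biUnion_le.trans ?_)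
  refine (Finset.sum_le_card_nsmul _ _ (n ^ 4) ?_).trans ?_
  · intro p hp
    simp only [Finset.mem_filter, Finset.mem_univ, true_and] at hp
    exact card_eq_coord p.1 p.2 hp
  · rw [smul_eq_mul]
    refine Nat.mul_le_mul_right _ ?_
    exact (Finset.card_le_univ _).trans (by simp)

section rnd
variable {n : ℕ} (A : Fin n → Bool)

def key (u v : Fin n) : Fin n × Fin n := if A u then (u, v) else (v, u)

lemma key_symm (u v : Fin n) (h : A u ≠ A v) : key A u v = key A v u := by
  unfold key
  cases hu : A u <;> cases hv : A v <;> simp_all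

/-- bipartite graph from a random function -/
def rG (f : Fin n × Fin n → Fin 6) : SimpleGraph (Fin n) where
  Adj u v := A u ≠ A v ∧ f (key A u v) ≠ 0
  symm := ⟨fun u v h => ⟨h.1.symm, by rw [← key_symm A u v h.1]; exact h.2⟩⟩
  loopless := ⟨fun u h => h.1 rfl⟩

def compat (x : Fin 5 → Fin n) : Prop :=
  A (x 0) = A (x 2) ∧ A (x 1) = A (x 3) ∧ A (x 1) = A (x 4) ∧ A (x 0) ≠ A (x 1)

lemma key_inj {u v u' v' : Fin n} {s : Bool} (hu : A u = s) (hu' : A u' = s)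
    (h : key A u v = key A u' v') : u = u' ∧ v = v' := by
  unfold key at h
  cases s
  · simp [hu, hu'] at h
    exact ⟨h.2, h.1⟩
  · simp [hu, hu'] at h
    exact h

lemma count_f (x : Fin 5 → Fin n) (hx : compat A x) (hi : Function.Injective x) :
    6 ^ (n * n) * 5 ^ 5 ≤
      (Finset.univ.filter (fun f : Fin n × Fin n → Fin 6 => good (rG A f) x)).card * 6 ^ 6 := by
  obtain ⟨h02, h13, h14, h01⟩ := hx
  let k : Fin 6 → Fin n × Fin n := ![key A (x 0) (x 1), key A (x 2) (x 1), key A (x 2) (x 3),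
    key A (x 0) (x 3), key A (x 0) (x 4), key A (x 2) (x 4)]
  have hk : Function.Injective k := by
    have n1 : x 0 ≠ x 2 := fun h => absurd (hi h) (by decide)
    have n2 : x 1 ≠ x 3 := fun h => absurd (hi h) (by decide)
    have n3 : x 1 ≠ x 4 := fun h => absurd (hi h) (by decide)
    have n4 : x 3 ≠ x 4 := fun h => absurd (hi h) (by decide)
    intro i j hij
    by_contra hne
    fin_cases i <;> fin_cases j <;> simp only [k, Matrix.cons_val] at hij <;>
    first
    | exact hne rfl
    | (have := key_inj A (s := A (x 0)) (by first | rfl | exact h02.symm)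
          (by first | rfl | exact h02.symm) hij
       first
       | exact n1 this.1 | exact n1 this.1.symm | exact n2 this.2 | exact n2 this.2.symm
       | exact n3 this.2 | exact n3 this.2.symm | exact n4 this.2 | exact n4 this.2.symm)
  let S : Fin n × Fin n → Finset (Fin 6) := fun p =>
    if p = k 5 then {0} else if p ∈ Finset.univ.image k then {0}ᶜ else Finset.univ
  have hsub : Fintype.piFinset S ⊆
      Finset.univ.filter (fun f : Fin n × Fin n → Fin 6 => good (rG A f) x) := by
    intro f hf
    rw [Fintype.mem_piFinset] at hf
    have h5 : f (k 5) = 0 := by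
      have := hf (k 5)
      simpa [S] using this
    have hne : ∀ i, i ≠ 5 → f (k i) ≠ 0 := by
      intro i hi5
      have := hf (k i)
      have h1 : k i ≠ k 5 := fun h => hi5 (hk h)
      simpa [S, h1] using this
    rw [Finset.mem_filter]
    refine ⟨Finset.mem_univ _, ⟨h01, hne 0 (by decide)⟩, ⟨?_, ?_⟩, ⟨?_, hne 2 (by decide)⟩,
      ⟨?_, hne 3 (by decide)⟩, ⟨?_, hne 4 (by decide)⟩, ?_, ?_, ?_, ?_, ?_, ?_⟩
    · rw [← h02]; exact h01.symm
    · rw [key_symm A _ _ (by rw [← h02]; exact h01.symm)]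
      exact hne 1 (by decide)
    · rw [← h02, ← h13]; exact h01
    · rw [← h13]; exact h01
    · rw [← h14]; exact h01
    · exact fun h => h.1 h02
    · exact fun h => h.1 h13
    · exact fun h => h.1 h14
    · exact fun h => h.2 h5
    · exact fun h => h.1 (h13.symm.trans h14)
    · exact fun h => absurd (hi h) (by decide)
  refine le_trans ?_ (Nat.mul_le_mul_right _ (Finset.card_le_card hsub))
  rw [Fintype.card_piFinset, ← Finset.prod_mul_prod_compl (Finset.univ.image k),
    Finset.prod_image (fun a _ b _ h => hk h)]
  have e1 : ∏ i, (S (k i)).card = 5 ^ 5 := by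
    have : ∀ i, (S (k i)).card = if i = 5 then 1 else 5 := by
      intro i
      by_cases h : i = 5
      · subst h; simp [S]
      · have h1 : k i ≠ k 5 := fun hh => h (hk hh)
        simp [S, h1, h, Finset.card_compl]
    simp only [this]
    decide
  have e2 : ∏ p ∈ (Finset.univ.image k)ᶜ, (S p).card = 6 ^ ((Finset.univ.image k)ᶜ).card := by
    rw [← Finset.prod_const]
    refine Finset.prod_congr rfl fun p hp => ?_
    have hp1 : p ∉ Finset.univ.image k := Finset.mem_compl.1 hp
    have hp2 : p ≠ k 5 := by
      rintro rfl
      exact hp1 (Finset.mem_image_of_mem _ (Finset.mem_univ _))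
    simp only [S, if_neg hp1, if_neg hp2]
    simp
  have e3 : ((Finset.univ.image k)ᶜ).card + 6 = n * n := by
    have := Finset.card_compl_add_card (Finset.univ.image k)
    rw [Finset.card_image_of_injective _ hk] at this
    simpa using this
  rw [e1, e2, ← e3, pow_add]
  apply le_of_eq
  ring

lemma rnd_avg : ∃ G : SimpleGraph (Fin n),
    (Finset.univ.filter (fun x => compat A x ∧ Function.Injective x)).card * 5 ^ 5 ≤
      (E G).card * 6 ^ 6 := by
  by_contra hcon
  push Not at hcon
  set X := Finset.univ.filter (fun x => compat A x ∧ Function.Injective x) with hX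
  have h1 : ∑ f : Fin n × Fin n → Fin 6, (E (rG A f)).card * 6 ^ 6 <
      ∑ f : Fin n × Fin n → Fin 6, X.card * 5 ^ 5 :=
    Finset.sum_lt_sum_of_nonempty Finset.univ_nonempty (fun f _ => hcon (rG A f))
  have h2 : ∑ f : Fin n × Fin n → Fin 6, X.card * 5 ^ 5 = X.card * (6 ^ (n * n) * 5 ^ 5) := by
    rw [Finset.sum_const, Finset.card_univ]
    simp
    ring
  have h3 : ∑ f : Fin n × Fin n → Fin 6, (E (rG A f)).card =
      ∑ x : Fin 5 → Fin n,
        (Finset.univ.filter (fun f : Fin n × Fin n → Fin 6 => good (rG A f) x)).card := by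
    simp only [E, Finset.card_filter]
    rw [Finset.sum_comm]
  have h4 : X.card * (6 ^ (n * n) * 5 ^ 5) ≤
      ∑ f : Fin n × Fin n → Fin 6, (E (rG A f)).card * 6 ^ 6 := by
    rw [← Finset.sum_mul, h3, Finset.sum_mul, ← smul_eq_mul, ← Finset.sum_const]
    refine le_trans (Finset.sum_le_sum (fun x hx => ?_))
      (Finset.sum_le_sum_of_subset (Finset.subset_univ X))
    rw [hX, Finset.mem_filter] at hx
    exact count_f A x hx.2.1 hx.2.2
  omega

end rnd

lemma card_compat {n : ℕ} (A : Fin n → Bool) (s : Bool) :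
    (Finset.univ.filter (fun x : Fin 5 → Fin n => compat A x ∧ A (x 0) = s)).card =
      (Finset.univ.filter (fun v => A v = s)).card ^ 2 *
      (Finset.univ.filter (fun v => A v = !s)).card ^ 3 := by
  have : (Finset.univ.filter (fun x : Fin 5 → Fin n => compat A x ∧ A (x 0) = s)) =
      Fintype.piFinset (![Finset.univ.filter (fun v => A v = s),
        Finset.univ.filter (fun v => A v = !s), Finset.univ.filter (fun v => A v = s),
        Finset.univ.filter (fun v => A v = !s), Finset.univ.filter (fun v => A v = !s)]) := by
    ext x
    rw [Finset.mem_filter, Fintype.mem_piFinset, compat]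
    simp only [Finset.mem_univ, true_and, Fin.forall_fin_succ]
    simp
    generalize A (x 0) = a0
    generalize A (x 1) = a1
    generalize A (x 2) = a2
    generalize A (x 3) = a3
    generalize A (x 4) = a4
    revert s a0 a1 a2 a3 a4
    decide
  rw [this, Fintype.card_piFinset]
  simp [Fin.prod_univ_succ]
  ring

theorem rnd_lower (n : ℕ) : ∃ G : SimpleGraph (Fin n),
    3125 / 746496 * (n : ℝ) ^ 5 - 2 * (n : ℝ) ^ 4 ≤ ((E G).card : ℝ) := by
  let A : Fin n → Bool := fun v => decide (v.1 < n / 2)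
  obtain ⟨G, hG⟩ := rnd_avg A
  refine ⟨G, ?_⟩
  have ha : (Finset.univ.filter (fun v => A v = true)).card = n / 2 := by
    have := Fin.card_filter_val_lt (n := n) (m := n / 2)
    simp only [A, decide_eq_true_eq]
    rw [this]; omega
  have hb : (Finset.univ.filter (fun v => A v = false)).card = n - n / 2 := by
    have h1 := Finset.card_filter_add_card_filter_not (s := (Finset.univ : Finset (Fin n)))
      (fun v => A v = true)
    rw [ha] at h1
    simp only [Bool.not_eq_true, Finset.card_univ, Fintype.card_fin] at h1
    omega
  have h1 := card_compat A true
  have h2 := card_compat A false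
  simp only [Bool.not_true, Bool.not_false, ha, hb] at h1 h2
  have h3 : (Finset.univ.filter (fun x => compat A x)).card =
      (Finset.univ.filter (fun x => compat A x ∧ A (x 0) = true)).card +
      (Finset.univ.filter (fun x => compat A x ∧ A (x 0) = false)).card := by
    have := Finset.card_filter_add_card_filter_not
      (s := (Finset.univ.filter (fun x => compat A x))) (fun x => A (x 0) = true)
    simp only [Finset.filter_filter, Bool.not_eq_true] at this
    exact this.symm
  have h4 : (Finset.univ.filter (fun x => compat A x)).card ≤
      (Finset.univ.filter (fun x => compat A x ∧ Function.Injective x)).card +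
      25 * n ^ 4 := by
    have := Finset.card_filter_add_card_filter_not
      (s := (Finset.univ.filter (fun x => compat A x))) (fun x => Function.Injective x)
    simp only [Finset.filter_filter] at this
    rw [← this]
    refine Nat.add_le_add_left ((Finset.card_le_card ?_).trans card_not_inj) _
    intro x hx
    simp only [Finset.mem_filter, Finset.mem_univ, true_and] at hx ⊢
    exact hx.2
  rw [h3, h1, h2] at h4
  obtain ⟨a, b, hab, ha', hb', hd⟩ : ∃ a b : ℕ, a + b = n ∧ n / 2 = a ∧ n - n / 2 = b ∧
      (b = a ∨ b = a + 1) := ⟨n / 2, n - n / 2, by omega, rfl, rfl, by omega⟩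
  rw [hb', ha'] at h4
  have h4' : ((a : ℝ) ^ 2 * b ^ 3 + b ^ 2 * a ^ 3) ≤
    ((Finset.univ.filter (fun x => compat A x ∧ Function.Injective x)).card : ℝ) +
      25 * (n : ℝ) ^ 4 := by exact_mod_cast h4
  have hG' : ((Finset.univ.filter (fun x => compat A x ∧ Function.Injective x)).card : ℝ) * 5 ^ 5
      ≤ (E G).card * 6 ^ 6 := by exact_mod_cast hG
  have hab' : (a : ℝ) + b = n := by exact_mod_cast hab
  have hn : (n:ℝ) = 0 ∨ 1 ≤ (n : ℝ) := by
    rcases Nat.eq_zero_or_pos n with h | h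
    · left; exact_mod_cast h
    · right; exact_mod_cast h
  have hprod : (n:ℝ) ^ 2 - 1 ≤ 4 * (a * b) := by
    rw [← hab']
    rcases hd with h | h
    · rw [h]; nlinarith
    · rw [h]; push_cast; nlinarith
  have hkey : (n : ℝ) ^ 5 / 16 - n ^ 4 / 8 ≤ (a : ℝ) ^ 2 * b ^ 3 + b ^ 2 * a ^ 3 := by
    have e : (a : ℝ) ^ 2 * b ^ 3 + b ^ 2 * a ^ 3 = (a * b) ^ 2 * n := by rw [← hab']; ring
    rw [e]
    rcases hn with h | h
    · rw [h]; norm_num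
    · have h0 : 0 ≤ (n:ℝ) ^ 2 - 1 := by nlinarith
      have h1 : ((n:ℝ) ^ 2 - 1) ^ 2 ≤ (4 * (a * b)) ^ 2 := pow_le_pow_left₀ h0 hprod 2
      have h2 : ((n:ℝ) ^ 2 - 1) ^ 2 * n ≤ (4 * (a * b)) ^ 2 * n :=
        mul_le_mul_of_nonneg_right h1 (by linarith)
      have h3 : (n:ℝ) ^ 3 ≤ n ^ 4 := pow_le_pow_right₀ h (by norm_num)
      nlinarith
  have : (n:ℝ)^4 ≥ 0 := by positivity
  linarith

end FCP

namespace FCP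

/-! ### Cloning -/

section clone
variable {n : ℕ}

/-- copies through a vertex -/
noncomputable def Ev (G : SimpleGraph (Fin n)) (v : Fin n) : Finset (Fin 5 → Fin n) :=
  (E G).filter (fun x => ∃ i, x i = v)

lemma card_two_coord (i j : Fin 5) (hij : i ≠ j) (u v : Fin n) :
    (Finset.univ.filter (fun x : Fin 5 → Fin n => x i = u ∧ x j = v)).card ≤ n ^ 3 := by
  have h : Fintype.card ({k : Fin 5 // k ∉ ({i, j} : Finset (Fin 5))} → Fin n) = n ^ 3 := by
    rw [Fintype.card_fun, Fintype.card_fin, Fintype.card_subtype_compl, Fintype.card_coe,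
      Finset.card_pair hij]
    rfl
  rw [← h, ← Finset.card_univ]
  refine Finset.card_le_card_of_injOn (fun x k => x k) (fun _ _ => by simp) ?_
  intro x hx y hy hxy
  simp only [Finset.coe_filter, Finset.mem_univ, true_and, Set.mem_ofPred_eq] at hx hy
  funext k
  by_cases hk : k = i
  · subst hk; rw [hx.1, hy.1]
  · by_cases hk' : k = j
    · subst hk'; rw [hx.2, hy.2]
    · exact congrFun hxy ⟨k, by simp [hk, hk']⟩

lemma card_two_range (u v : Fin n) (huv : u ≠ v) :
    (Finset.univ.filter (fun x : Fin 5 → Fin n => (∃ i, x i = u) ∧ (∃ j, x j = v))).card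
      ≤ 25 * n ^ 3 := by
  have hsub : (Finset.univ.filter
      (fun x : Fin 5 → Fin n => (∃ i, x i = u) ∧ (∃ j, x j = v))) ⊆
      (Finset.univ.filter (fun p : Fin 5 × Fin 5 => p.1 ≠ p.2)).biUnion
        (fun p => Finset.univ.filter (fun x : Fin 5 → Fin n => x p.1 = u ∧ x p.2 = v)) := by
    intro x hx
    rw [Finset.mem_filter] at hx
    obtain ⟨-, ⟨i, hi⟩, ⟨j, hj⟩⟩ := hx
    simp only [Finset.mem_biUnion, Finset.mem_filter, Finset.mem_univ, true_and]
    refine ⟨(i, j), ?_, hi, hj⟩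
    rintro h
    simp only at h
    subst h
    exact huv (hi.symm.trans hj)
  refine (Finset.card_le_card hsub).trans (Finset.card_biUnion_le.trans ?_)
  refine (Finset.sum_le_card_nsmul _ _ (n ^ 3) ?_).trans ?_
  · intro p hp
    simp only [Finset.mem_filter, Finset.mem_univ, true_and] at hp
    exact card_two_coord p.1 p.2 hp u v
  · rw [smul_eq_mul]
    refine Nat.mul_le_mul_right _ ?_
    exact (Finset.card_le_univ _).trans (by simp)

lemma sum_Ev (G : SimpleGraph (Fin n)) : ∑ v, (Ev G v).card = 5 * (E G).card := by
  simp only [Ev, Finset.card_filter]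
  rw [Finset.sum_comm]
  rw [Finset.sum_const_nat (m := 5), mul_comm]
  intro x hx
  rw [← Finset.card_filter]
  have : (Finset.univ.filter (fun v => ∃ i, x i = v)) = Finset.univ.image x := by
    ext v; simp
  rw [this]
  exact good_image_card (mem_E.1 hx)

lemma good_comap {V W : Type*} (G : SimpleGraph V) (π : W → V) (x : Fin 5 → W)
    (h : good G (π ∘ x)) : good (G.comap π) x := by
  obtain ⟨h1, h2, h3, h4, h5, h6, h7, h8, h9, h10, h11⟩ := h
  exact ⟨h1, h2, h3, h4, h5, h6, h7, h8, h9, h10, fun h => h11 (congrArg π h)⟩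

lemma clone (G : SimpleGraph (Fin n)) (H : ∀ G' : SimpleGraph (Fin n), (E G').card ≤ (E G).card)
    (u v : Fin n) : (Ev G u).card ≤ (Ev G v).card + 25 * n ^ 3 := by
  by_cases huv : u = v
  · subst huv; omega
  let π : Fin n → Fin n := fun w => if w = v then u else w
  let A := (E G).filter (fun x => ¬ ∃ i, x i = v)
  let B := (Ev G u).filter (fun x => ¬ ∃ i, x i = v)
  let B' := B.image (fun x => (Equiv.swap u v) ∘ x)
  have hB' : B'.card = B.card := by
    refine Finset.card_image_of_injective _ ?_
    intro x y hxy
    funext i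
    exact (Equiv.swap u v).injective (congrFun hxy i)
  have hdisj : Disjoint A B' := by
    rw [Finset.disjoint_left]
    intro x hx hx'
    rw [Finset.mem_filter] at hx
    rw [Finset.mem_image] at hx'
    obtain ⟨y, hy, rfl⟩ := hx'
    rw [Finset.mem_filter, Ev, Finset.mem_filter] at hy
    obtain ⟨i, hi⟩ := hy.1.2
    exact hx.2 ⟨i, by simp [hi]⟩
  have hsub : A ∪ B' ⊆ E (G.comap π) := by
    intro x hx
    rw [Finset.mem_union] at hx
    rw [mem_E]
    apply good_comap
    rcases hx with hx | hx
    · rw [Finset.mem_filter, mem_E] at hx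
      have : π ∘ x = x := by
        funext i
        have : x i ≠ v := fun h => hx.2 ⟨i, h⟩
        simp [π, this]
      rw [this]; exact hx.1
    · rw [Finset.mem_image] at hx
      obtain ⟨y, hy, rfl⟩ := hx
      rw [Finset.mem_filter, Ev, Finset.mem_filter, mem_E] at hy
      have : π ∘ ((Equiv.swap u v) ∘ y) = y := by
        funext i
        have h1 : y i ≠ v := fun h => hy.2 ⟨i, h⟩
        by_cases h2 : y i = u
        · simp [π, h2]
        · simp [π, Equiv.swap_apply_of_ne_of_ne h2 h1, h1]
      rw [this]; exact hy.1.1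
  have h1 := (Finset.card_le_card hsub).trans (H _)
  rw [Finset.card_union_of_disjoint hdisj, hB'] at h1
  have h2 : (Ev G v).card + A.card = (E G).card :=
    Finset.card_filter_add_card_filter_not (s := E G) (fun x => ∃ i, x i = v)
  have h3 := Finset.card_filter_add_card_filter_not (s := Ev G u) (fun x => ∃ i, x i = v)
  have h4 : ((Ev G u).filter (fun x => ∃ i, x i = v)).card ≤ 25 * n ^ 3 := by
    refine le_trans (Finset.card_le_card ?_) (card_two_range u v huv)
    intro x hx
    rw [Finset.mem_filter, Ev, Finset.mem_filter] at hx
    rw [Finset.mem_filter]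
    exact ⟨Finset.mem_univ _, hx.1.2, hx.2⟩
  change _ + B.card = _ at h3
  omega

lemma Ev_lower (G : SimpleGraph (Fin n))
    (H : ∀ G' : SimpleGraph (Fin n), (E G').card ≤ (E G).card) (v : Fin n) :
    5 * (E G).card ≤ n * (Ev G v).card + 25 * n ^ 4 := by
  rw [← sum_Ev]
  refine (Finset.sum_le_card_nsmul _ _ _ (fun u _ => clone G H u v)).trans ?_
  simp only [Finset.card_univ, Fintype.card_fin, smul_eq_mul]
  apply le_of_eq
  ring

end clone

end FCP

namespace FCP

/-! ### Vertex regularity -/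

section reg
variable {n : ℕ} (G : SimpleGraph (Fin n))

/-- neighbourhood -/
noncomputable def N (v : Fin n) : Finset (Fin n) := Finset.univ.filter (fun u => G.Adj v u)

lemma mem_N {u v : Fin n} : u ∈ N G v ↔ G.Adj v u := by simp [N]

/-- triangles at a vertex -/
noncomputable def triV (v : Fin n) : Finset (Fin n × Fin n) :=
  Finset.univ.filter (fun p => G.Adj v p.1 ∧ G.Adj v p.2 ∧ G.Adj p.1 p.2)

/-- closed five walks at a vertex -/
noncomputable def cycV (v : Fin n) : Finset (Fin n × Fin n × Fin n × Fin n) :=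
  Finset.univ.filter (fun p => G.Adj v p.1 ∧ G.Adj p.1 p.2.1 ∧ G.Adj p.2.1 p.2.2.1 ∧
    G.Adj p.2.2.1 p.2.2.2 ∧ G.Adj v p.2.2.2)

/-- adjacency as a boolean -/
noncomputable def bG (u v : Fin n) : Bool := decide (G.Adj u v)

lemma bG_symm (u v : Fin n) : bG G u v = bG G v u := by
  simp [bG, G.adj_comm]

/-- the weight -/
noncomputable def wt (v : Fin n) (s : ℝ) (u : Fin n) : ℝ := 1 + if u = v then s else 0

lemma wt_one (v : Fin n) (s : ℝ) (hs : 0 ≤ s) (u : Fin n) : 1 ≤ wt v s u := by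
  unfold wt; split_ifs <;> linarith

lemma wt_self (v : Fin n) (s : ℝ) : wt v s v = 1 + s := by simp [wt]

lemma sum_wt (v : Fin n) (s : ℝ) : ∑ u, wt v s u = n + s := by
  simp [wt, Finset.sum_add_distrib]

lemma f0X_good (x : Fin 5 → Fin n) (h : good G x) : f0X (bG G) x = 1 := by
  obtain ⟨h1, h2, h3, h4, h5, h6, h7, h8, h9, h10, -⟩ := h
  simp [f0X, bG, f0B, *]

lemma bit_nonneg (c : Bool) : (0:ℤ) ≤ cond c 1 0 := by cases c <;> simp

lemma f0X_nonneg (x : Fin 5 → Fin n) : 0 ≤ f0X (bG G) x := by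
  exact bit_nonneg _

lemma prod_wt (v : Fin n) (s : ℝ) (hs : 0 ≤ s) (x : Fin 5 → Fin n) (h : ∃ i, x i = v) :
    1 + s ≤ ∏ i, wt v s (x i) := by
  obtain ⟨i, hi⟩ := h
  rw [← Finset.mul_prod_erase _ _ (Finset.mem_univ i), hi, wt_self]
  have : 1 ≤ ∏ j ∈ Finset.univ.erase i, wt v s (x j) := by
    have := Finset.prod_le_prod (s := Finset.univ.erase i) (f := fun _ => (1:ℝ))
      (g := fun j => wt v s (x j)) (fun _ _ => zero_le_one) (fun j _ => wt_one v s hs _)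
    simpa using this
  nlinarith

lemma prod_wt_one (v : Fin n) (s : ℝ) (hs : 0 ≤ s) (x : Fin 5 → Fin n) :
    1 ≤ ∏ i, wt v s (x i) := by
  have := Finset.prod_le_prod (s := (Finset.univ : Finset (Fin 5))) (f := fun _ => (1:ℝ))
      (g := fun j => wt v s (x j)) (fun _ _ => zero_le_one) (fun j _ => wt_one v s hs _)
  simpa using this

lemma T_f0 (v : Fin n) (s : ℝ) (hs : 0 ≤ s) :
    ((E G).card : ℝ) + s * (Ev G v).card ≤ T (wt v s) (fun x => (f0X (bG G) x : ℝ)) := by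
  have h1 : ((E G).card : ℝ) + s * (Ev G v).card =
      ∑ x ∈ E G, (1 + if (∃ i, x i = v) then s else 0) := by
    rw [Finset.sum_add_distrib, Finset.sum_const, nsmul_eq_mul, mul_one, Ev,
      ← Finset.sum_filter, Finset.sum_const, nsmul_eq_mul, mul_comm s]
  rw [h1, T]
  refine le_trans (Finset.sum_le_sum (fun x hx => ?_))
    (Finset.sum_le_sum_of_subset_of_nonneg (Finset.subset_univ (E G)) (fun x _ _ => ?_))
  · rw [f0X_good G x (mem_E.1 hx)]
    split_ifs with h
    · simpa using prod_wt v s hs x h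
    · simpa using prod_wt_one v s hs x
  · refine mul_nonneg (by linarith [prod_wt_one v s hs x]) ?_
    exact_mod_cast f0X_nonneg G x

lemma T_ge (v : Fin n) (s : ℝ) (hs : 0 ≤ s) (g : (Fin 5 → Fin n) → ℝ) (hg : ∀ x, 0 ≤ g x) :
    s * ∑ q, ∑ r, ∑ y, ∑ z, g ![v, q, r, y, z] ≤ T (wt v s) g := by
  rw [T_eq]
  have h0 : ∀ u, 0 ≤ wt v s u := fun u => by linarith [wt_one v s hs u]
  refine le_trans ?_ (Finset.single_le_sum (f := fun p => ∑ q, ∑ r, ∑ y, ∑ z,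
    wt v s p * wt v s q * wt v s r * (wt v s y * wt v s z * g ![p, q, r, y, z]))
    (fun p _ => ?_) (Finset.mem_univ v))
  · simp only [Finset.mul_sum]
    refine Finset.sum_le_sum fun q _ => Finset.sum_le_sum fun r _ => Finset.sum_le_sum fun y _ =>
      Finset.sum_le_sum fun z _ => ?_
    have h1 : s ≤ wt v s v * wt v s q * wt v s r * (wt v s y * wt v s z) := by
      have a1 := wt_one v s hs q
      have a2 := wt_one v s hs r
      have a3 := wt_one v s hs y
      have a4 := wt_one v s hs z
      rw [wt_self]
      have b1 : 1 ≤ wt v s q * wt v s r := one_le_mul_of_one_le_of_one_le a1 a2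
      have b2 : 1 ≤ wt v s y * wt v s z := one_le_mul_of_one_le_of_one_le a3 a4
      have b3 : 1 ≤ (wt v s q * wt v s r) * (wt v s y * wt v s z) :=
        one_le_mul_of_one_le_of_one_le b1 b2
      nlinarith
    calc s * g ![v, q, r, y, z]
        ≤ (wt v s v * wt v s q * wt v s r * (wt v s y * wt v s z)) * g ![v, q, r, y, z] :=
          mul_le_mul_of_nonneg_right h1 (hg _)
      _ = _ := by ring
  · refine Finset.sum_nonneg fun q _ => Finset.sum_nonneg fun r _ => Finset.sum_nonneg fun y _ =>
      Finset.sum_nonneg fun z _ => ?_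
    have := hg ![p, q, r, y, z]
    have := h0 p
    have := h0 q
    have := h0 r
    have := h0 y
    have := h0 z
    positivity

lemma T_tri (v : Fin n) (s : ℝ) (hs : 0 ≤ s) :
    s * ((n : ℝ) ^ 2 * (triV G v).card) ≤ T (wt v s) (fun x => (triX (bG G) x : ℝ)) := by
  refine le_trans (le_of_eq ?_) (T_ge v s hs _ ?_)
  · congr 1
    rw [triV, Finset.card_filter]
    push_cast
    rw [Fintype.sum_prod_type, Finset.mul_sum]
    refine Finset.sum_congr rfl fun q _ => ?_
    rw [Finset.mul_sum]
    refine Finset.sum_congr rfl fun r _ => ?_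
    simp only [triX, tri, Matrix.cons_val, bG]
    by_cases h1 : G.Adj v q <;> by_cases h2 : G.Adj v r <;> by_cases h3 : G.Adj q r <;>
      simp [h1, h2, h3, sq]
  · intro x
    simp only [triX, tri]
    cases (bG G (x 0) (x 1) && bG G (x 0) (x 2) && bG G (x 1) (x 2)) <;> simp

lemma T_cyc (v : Fin n) (s : ℝ) (hs : 0 ≤ s) :
    s * ((cycV G v).card) ≤ T (wt v s) (fun x => (cycX (bG G) x : ℝ)) := by
  refine le_trans (le_of_eq ?_) (T_ge v s hs _ ?_)
  · congr 1
    rw [cycV, Finset.card_filter]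
    push_cast
    simp only [Fintype.sum_prod_type]
    refine Finset.sum_congr rfl fun q _ => Finset.sum_congr rfl fun r _ =>
      Finset.sum_congr rfl fun y _ => Finset.sum_congr rfl fun z _ => ?_
    simp only [cycX, cyc, Matrix.cons_val, bG]
    by_cases h1 : G.Adj v q <;> by_cases h2 : G.Adj q r <;> by_cases h3 : G.Adj r y <;>
    by_cases h4 : G.Adj y z <;> by_cases h5 : G.Adj v z <;>
      simp [h1, h2, h3, h4, h5]
  · intro x
    exact_mod_cast bit_nonneg _

lemma deg_sum (v : Fin n) (s : ℝ) :
    ∑ y, wt v s y * (gV (bG G v y) : ℝ) = 12 * (N G v).card - 5 * n - 5 * s := by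
  have e : ∀ y, wt v s y * (gV (bG G v y) : ℝ) =
      12 * (if G.Adj v y then 1 else 0) - 5 - 5 * (if y = v then s else 0) := by
    intro y
    by_cases h : y = v
    · subst h
      simp [wt, gV, bG]; ring
    · by_cases h2 : G.Adj v y
      · simp [wt, gV, bG, h, h2]; norm_num
      · simp [wt, gV, bG, h, h2]
  simp only [e]
  rw [Finset.sum_sub_distrib, Finset.sum_sub_distrib, ← Finset.mul_sum, ← Finset.mul_sum]
  simp [N]
  ring

lemma reg_ineq (H : ∀ G' : SimpleGraph (Fin n), (E G').card ≤ (E G).card) (v : Fin n)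
    (t : ℝ) (ht : 0 < t) (ht1 : t ≤ 1) :
    t * (n : ℝ) * ((n : ℝ) ^ 2 * (triV G v).card + (cycV G v).card +
      (n : ℝ) ^ 2 * (12 * (N G v).card - 5 * n - 5 * (t * n)) ^ 2) ≤
      14000 * t ^ 2 * (n : ℝ) ^ 5 + 4440000 * (n : ℝ) ^ 4 := by
  have hn : (0:ℝ) < n := by
    have : 0 < n := lt_of_le_of_lt (Nat.zero_le _) v.2
    exact_mod_cast this
  set s : ℝ := t * n with hs_def
  have hs : 0 ≤ s := by positivity
  have h0 := weighted (bG G) (wt v s) (fun u => by linarith [wt_one v s hs u]) (bG_symm G)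
  rw [sum_wt] at h0
  have h1 := T_f0 G v s hs
  have h2 := T_tri G v s hs
  have h3 := T_cyc G v s hs
  have h4 : s * ((n : ℝ) ^ 2 * (12 * (N G v).card - 5 * n - 5 * s) ^ 2) ≤
      (n + s) ^ 2 * ∑ r, wt v s r * (∑ y, wt v s y * (gV (bG G r y) : ℝ)) ^ 2 := by
    have a1 : (1 + s) * (12 * (N G v).card - 5 * n - 5 * s) ^ 2 ≤
        ∑ r, wt v s r * (∑ y, wt v s y * (gV (bG G r y) : ℝ)) ^ 2 := by
      rw [← deg_sum, ← wt_self v s]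
      exact Finset.single_le_sum (f := fun r => wt v s r *
        (∑ y, wt v s y * (gV (bG G r y) : ℝ)) ^ 2)
        (fun r _ => mul_nonneg (by linarith [wt_one v s hs r]) (sq_nonneg _)) (Finset.mem_univ v)
    have a2 : (n:ℝ) ^ 2 ≤ (n + s) ^ 2 := pow_le_pow_left₀ hn.le (by linarith) 2
    calc s * ((n : ℝ) ^ 2 * (12 * (N G v).card - 5 * n - 5 * s) ^ 2)
        = (n : ℝ) ^ 2 * (s * (12 * (N G v).card - 5 * n - 5 * s) ^ 2) := by ring
      _ ≤ (n + s) ^ 2 * ((1 + s) * (12 * (N G v).card - 5 * n - 5 * s) ^ 2) := by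
          refine mul_le_mul a2 ?_ (by positivity) (by positivity)
          exact mul_le_mul_of_nonneg_right (by linarith) (sq_nonneg _)
      _ ≤ _ := mul_le_mul_of_nonneg_left a1 (by positivity)
  obtain ⟨G', hG'⟩ := rnd_lower n
  have h5 : 3125 / 746496 * (n : ℝ) ^ 5 - 2 * (n : ℝ) ^ 4 ≤ ((E G).card : ℝ) :=
    hG'.trans (by exact_mod_cast H G')
  have h6 : 5 * ((E G).card : ℝ) ≤ n * (Ev G v).card + 25 * (n : ℝ) ^ 4 := by
    exact_mod_cast Ev_lower G H v
  have h7 : s * ((Ev G v).card : ℝ) = t * (n * (Ev G v).card) := by rw [hs_def]; ring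
  have h8 : t * (5 * (3125 / 746496 * (n : ℝ) ^ 5) - 35 * (n:ℝ) ^ 4) ≤
      t * (n * (Ev G v).card) := by
    refine mul_le_mul_of_nonneg_left ?_ ht.le
    linarith
  have h9 : (n + s) ^ 5 = (n : ℝ) ^ 5 * (1 + t) ^ 5 := by rw [hs_def]; ring
  have h10 : (1 + t) ^ 5 ≤ 1 + 5 * t + 26 * t ^ 2 := by
    have : t ^ 3 ≤ t ^ 2 := pow_le_pow_of_le_one ht.le ht1 (by norm_num)
    have : t ^ 4 ≤ t ^ 2 := pow_le_pow_of_le_one ht.le ht1 (by norm_num)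
    have : t ^ 5 ≤ t ^ 2 := pow_le_pow_of_le_one ht.le ht1 (by norm_num)
    nlinarith
  have h11 : (n : ℝ) ^ 5 * (1 + t) ^ 5 ≤ (n : ℝ) ^ 5 * (1 + 5 * t + 26 * t ^ 2) :=
    mul_le_mul_of_nonneg_left h10 (by positivity)
  rw [h9] at h0
  have h12 : t * (n:ℝ) ^ 4 ≤ (n:ℝ) ^ 4 := mul_le_of_le_one_left (by positivity) ht1
  have h13 : 0 ≤ t ^ 2 * (n:ℝ) ^ 5 := by positivity
  rw [h7] at h1
  nlinarith

theorem vertex_reg (η : ℝ) (h0 : 0 < η) (h1 : η ≤ 1) : ∃ n₀ : ℕ, ∀ n : ℕ, n₀ ≤ n →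
    ∀ G : SimpleGraph (Fin n), (∀ G' : SimpleGraph (Fin n), (E G').card ≤ (E G).card) →
    ∀ v, (5 / 12 - η) * (n : ℝ) ≤ (N G v).card ∧ ((N G v).card : ℝ) ≤ (5 / 12 + η) * n ∧
      ((triV G v).card : ℝ) ≤ η * n ^ 2 ∧ ((cycV G v).card : ℝ) ≤ η * n ^ 4 := by
  obtain ⟨n₀, hn₀⟩ := exists_nat_gt (10 ^ 13 / η ^ 4)
  refine ⟨n₀, fun n hn G H v => ?_⟩
  have hnn : 10 ^ 13 / η ^ 4 < (n : ℝ) := hn₀.trans_le (by exact_mod_cast hn)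
  have hnpos : (0:ℝ) < n := lt_trans (by positivity) hnn
  have hη2 : η ^ 2 ≤ η := by nlinarith
  set t := η ^ 2 / 100000 with ht
  have htp : 0 < t := by positivity
  have h := reg_ineq G H v t htp (by rw [ht]; nlinarith)
  set Q := ((n : ℝ) ^ 2 * (triV G v).card + (cycV G v).card +
      (n : ℝ) ^ 2 * (12 * (N G v).card - 5 * n - 5 * (t * n)) ^ 2) with hQ
  have hQle : Q ≤ η ^ 2 * (n:ℝ) ^ 4 := by
    by_contra hcon
    push Not at hcon
    have a1 : t * (n:ℝ) * (η ^ 2 * (n:ℝ) ^ 4) < t * n * Q :=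
      mul_lt_mul_of_pos_left hcon (by positivity)
    have a2 : (10:ℝ) ^ 13 < n * η ^ 4 := by rwa [div_lt_iff₀ (by positivity)] at hnn
    have a3 : (10:ℝ) ^ 13 * (n:ℝ) ^ 4 ≤ n * η ^ 4 * (n:ℝ) ^ 4 :=
      mul_le_mul_of_nonneg_right a2.le (by positivity)
    have a4 : t * (n:ℝ) * (η ^ 2 * (n:ℝ) ^ 4) = n * η ^ 4 * (n:ℝ) ^ 4 / 100000 := by
      rw [ht]; ring
    have a5 : 14000 * t ^ 2 * (n : ℝ) ^ 5 = 14000 / 10 ^ 10 * (n * η ^ 4 * (n:ℝ) ^ 4) := by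
      rw [ht]; ring
    have a6 : 0 < (n:ℝ) ^ 4 := by positivity
    rw [a4] at a1
    rw [a5] at h
    nlinarith
  have p1 : 0 ≤ (n : ℝ) ^ 2 * (triV G v).card := by positivity
  have p2 : 0 ≤ ((cycV G v).card : ℝ) := by positivity
  have p3 : 0 ≤ (n : ℝ) ^ 2 * (12 * ((N G v).card : ℝ) - 5 * n - 5 * (t * n)) ^ 2 := by positivity
  have n2 : (0:ℝ) < (n:ℝ) ^ 2 := by positivity
  have n4 : (0:ℝ) < (n:ℝ) ^ 4 := by positivity
  have hle : η ^ 2 * (n:ℝ) ^ 4 ≤ η * (n:ℝ) ^ 4 := mul_le_mul_of_nonneg_right hη2 n4.le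
  have hd : (12 * ((N G v).card : ℝ) - 5 * n - 5 * (t * n)) ^ 2 ≤ (η * n) ^ 2 := by
    refine le_of_mul_le_mul_left ?_ n2
    calc _ ≤ η ^ 2 * (n:ℝ) ^ 4 := by linarith
      _ = _ := by ring
  have hd2 := abs_le_of_sq_le_sq' hd (by positivity)
  have ht2 : t * n ≤ η * n / 10 := by
    have : t ≤ η / 10 := by rw [ht]; linarith
    calc t * n ≤ η / 10 * n := mul_le_mul_of_nonneg_right this hnpos.le
      _ = _ := by ring
  have ht3 : 0 ≤ t * n := by positivity
  have hen : 0 < η * n := by positivity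
  refine ⟨by linarith [hd2.1], by linarith [hd2.2], ?_, by linarith⟩
  refine le_of_mul_le_mul_left ?_ n2
  calc _ ≤ η * (n:ℝ) ^ 4 := by linarith
    _ = _ := by ring

end reg

end FCP

namespace FCP

/-! ### Approximate structure -/

section struct

lemma pc {α β γ : Type*} (X : Finset α) (F : α → Finset β) (S : Finset γ) (f : α → β → γ)
    (hf : Function.Injective2 f) (hF : ∀ x ∈ X, ∀ b ∈ F x, f x b ∈ S) (c : ℝ)
    (hc : ∀ x ∈ X, c ≤ ((F x).card : ℝ)) : (X.card : ℝ) * c ≤ S.card := by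
  have h1 : (X.sigma F).card ≤ S.card := by
    refine Finset.card_le_card_of_injOn (fun p => f p.1 p.2) ?_ ?_
    · rintro ⟨x, b⟩ h
      rw [Finset.mem_coe, Finset.mem_sigma] at h
      exact hF x h.1 b h.2
    · rintro ⟨x, b⟩ - ⟨x', b'⟩ - h
      obtain ⟨h1, h2⟩ := hf h
      subst h1; subst h2; rfl
  rw [Finset.card_sigma] at h1
  have h2 : (X.card : ℝ) * c ≤ ∑ x ∈ X, ((F x).card : ℝ) := by
    rw [← nsmul_eq_mul]
    exact Finset.card_nsmul_le_sum X _ c hc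
  refine h2.trans ?_
  exact_mod_cast h1

lemma inter_ge {α : Type*} [DecidableEq α] (A B C : Finset α) (hA : A ⊆ C) (hB : B ⊆ C) :
    (A.card : ℝ) + B.card ≤ (A ∩ B).card + C.card := by
  have h := Finset.card_union_add_card_inter A B
  have h2 := Finset.card_le_card (Finset.union_subset hA hB)
  have : A.card + B.card ≤ (A ∩ B).card + C.card := by omega
  exact_mod_cast this

lemma split_card {α : Type*} [DecidableEq α] [Fintype α] (A S : Finset α) :
    (A.card : ℝ) = (A ∩ S).card + (A ∩ Sᶜ).card := by
  have h := Finset.card_inter_add_card_sdiff A S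
  rw [Finset.sdiff_eq_inter_compl] at h
  exact_mod_cast h.symm

lemma compl_card {n : ℕ} (S : Finset (Fin n)) : (Sᶜ.card : ℝ) = n - S.card := by
  have := Finset.card_add_card_compl S
  rw [Fintype.card_fin] at this
  have h : (S.card : ℝ) + Sᶜ.card = n := by exact_mod_cast this
  linarith

variable {n : ℕ} (G : SimpleGraph (Fin n))

/-- regularity hypothesis -/
def Reg (η : ℝ) : Prop :=
    ∀ v, (5 / 12 - η) * (n : ℝ) ≤ (N G v).card ∧ ((N G v).card : ℝ) ≤ (5 / 12 + η) * n ∧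
      ((triV G v).card : ℝ) ≤ η * n ^ 2 ∧ ((cycV G v).card : ℝ) ≤ η * n ^ 4

lemma tri_count (v : Fin n) (X : Finset (Fin n)) (hX : X ⊆ N G v) (c : ℝ)
    (hc : ∀ x ∈ X, c ≤ ((N G x ∩ N G v).card : ℝ)) : (X.card : ℝ) * c ≤ (triV G v).card := by
  refine pc X (fun x => N G x ∩ N G v) (triV G v) (fun x y => (x, y)) ?_ ?_ c hc
  · intro a b c d h
    simpa using h
  · intro x hx y hy
    rw [Finset.mem_inter, mem_N, mem_N] at hy
    simp only [triV, Finset.mem_filter, Finset.mem_univ, true_and]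
    exact ⟨(mem_N G).1 (hX hx), hy.2, hy.1⟩

theorem approx (η : ℝ) (h0 : 0 < η) (h1 : η ≤ 1 / 10 ^ 5) (hn : 0 < n) (R : Reg G η) :
    ∃ V0 : Finset (Fin n), (∀ u ∈ V0, ((N G u ∩ V0).card : ℝ) ≤ 10 ^ 4 * η * n) ∧
      (∀ u ∈ V0ᶜ, ((N G u ∩ V0ᶜ).card : ℝ) ≤ 10 ^ 4 * η * n) := by
  have hnr : (0:ℝ) < n := by exact_mod_cast hn
  have hen : 0 < η * n := by positivity
  have hen1 : η * n ≤ n / 10 ^ 5 := by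
    have := mul_le_mul_of_nonneg_right h1 hnr.le
    linarith
  let v : Fin n := ⟨0, hn⟩
  let V0 : Finset (Fin n) := Finset.univ.filter (fun u => (n:ℝ) / 24 ≤ ((N G u ∩ N G v).card : ℝ))
  have hV0 : ∀ u, u ∈ V0 ↔ (n:ℝ) / 24 ≤ ((N G u ∩ N G v).card : ℝ) := fun u => by simp [V0]
  have ha : ∀ u ∈ V0ᶜ, ((N G u ∩ V0ᶜ).card : ℝ) ≤ 8 * (η * n) := by
    intro u hu
    rw [Finset.mem_compl, hV0, not_le] at hu
    have := tri_count G u (N G u ∩ V0ᶜ) Finset.inter_subset_left (n / 8) (by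
      intro w hw
      rw [Finset.mem_inter, Finset.mem_compl, hV0, not_le] at hw
      have e1 := split_card (N G u) (N G v)
      have e2 := split_card (N G w) (N G v)
      have e3 := inter_ge (N G w ∩ (N G v)ᶜ) (N G u ∩ (N G v)ᶜ) (N G v)ᶜ
        Finset.inter_subset_right Finset.inter_subset_right
      have e4 := compl_card (N G v)
      have e5 : (((N G w ∩ (N G v)ᶜ) ∩ (N G u ∩ (N G v)ᶜ)).card : ℝ) ≤
          (N G w ∩ N G u).card := by
        have : (N G w ∩ (N G v)ᶜ) ∩ (N G u ∩ (N G v)ᶜ) ⊆ N G w ∩ N G u :=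
          Finset.inter_subset_inter Finset.inter_subset_left Finset.inter_subset_left
        exact_mod_cast Finset.card_le_card this
      have r1 := (R u).1
      have r2 := (R w).1
      have r3 := (R v).1
      linarith [hw.2])
    have r := (R u).2.2.1
    have : (n:ℝ) * (((N G u ∩ V0ᶜ).card : ℝ)) ≤ n * (8 * (η * n)) := by nlinarith
    exact le_of_mul_le_mul_left this hnr
  -- edges inside V0
  let P0 : Finset (Fin n × Fin n) := (V0 ×ˢ V0).filter (fun p => G.Adj p.1 p.2)
  have hP0 : (P0.card : ℝ) ≤ 576 * η * n ^ 2 := by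
    have := pc P0 (fun p => (N G p.1 ∩ N G v) ×ˢ (N G p.2 ∩ N G v)) (cycV G v)
      (fun p a => (a.1, p.1, p.2, a.2)) (by
        rintro ⟨a1, a2⟩ ⟨a1', a2'⟩ ⟨b1, b2⟩ ⟨b1', b2'⟩ h
        simp only [Prod.mk.injEq] at h ⊢
        tauto) (by
        rintro ⟨p, q⟩ hp ⟨a, d⟩ ha
        simp only [P0, Finset.mem_filter, Finset.mem_product, Finset.mem_inter, mem_N] at hp ha
        simp only [cycV, Finset.mem_filter, Finset.mem_univ, true_and]
        exact ⟨ha.1.2, ha.1.1.symm, hp.2, ha.2.1, ha.2.2⟩) ((n / 24) ^ 2) (by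
        rintro ⟨p, q⟩ hp
        simp only [P0, Finset.mem_filter, Finset.mem_product, hV0] at hp
        rw [Finset.card_product]
        push_cast
        rw [sq]
        exact mul_le_mul hp.1.1 hp.1.2 (by positivity) (by positivity))
    have r := (R v).2.2.2
    have : (n:ℝ) ^ 2 * (P0.card : ℝ) ≤ n ^ 2 * (576 * η * n ^ 2) := by nlinarith
    exact le_of_mul_le_mul_left this (by positivity)
  let At : Finset (Fin n) := V0.filter (fun x => (n:ℝ) / 12 ≤ ((N G x ∩ V0).card : ℝ))
  have hAt : (At.card : ℝ) ≤ 6912 * (η * n) := by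
    have := pc At (fun p => N G p ∩ V0) P0 (fun p a => (p, a)) (by
        intro a b c d h
        simpa using h) (by
        intro p hp a ha
        simp only [At, P0, Finset.mem_filter, Finset.mem_product, Finset.mem_inter, mem_N]
          at hp ha ⊢
        exact ⟨⟨hp.1, ha.2⟩, ha.1⟩) (n / 12) (by
        intro p hp
        exact (Finset.mem_filter.1 hp).2)
    have : (n:ℝ) * (At.card : ℝ) ≤ n * (6912 * (η * n)) := by nlinarith
    exact le_of_mul_le_mul_left this (by positivity)
  have hNv : ((N G v ∩ V0).card : ℝ) ≤ 24 * (η * n) := by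
    have := tri_count G v (N G v ∩ V0) Finset.inter_subset_left (n / 24) (by
      intro w hw
      exact (hV0 w).1 (Finset.mem_inter.1 hw).2)
    have r := (R v).2.2.1
    have : (n:ℝ) * (((N G v ∩ V0).card : ℝ)) ≤ n * (24 * (η * n)) := by nlinarith
    exact le_of_mul_le_mul_left this hnr
  have hV0c : (V0.card : ℝ) ≤ 7 / 12 * n + 25 * (η * n) := by
    have e1 := split_card (N G v) V0
    have e2 : ((N G v ∩ V0ᶜ).card : ℝ) ≤ V0ᶜ.card := by
      exact_mod_cast Finset.card_le_card Finset.inter_subset_right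
    have e3 := compl_card V0
    have r := (R v).1
    linarith
  refine ⟨V0, ?_, fun u hu => (ha u hu).trans (by nlinarith)⟩
  intro u hu
  have hu' := (hV0 u).1 hu
  let X := (N G u ∩ V0) \ At
  let Y := N G u ∩ N G v ∩ V0ᶜ
  have hY : (n:ℝ) / 48 ≤ Y.card := by
    have e1 := split_card (N G u ∩ N G v) V0
    have e2 : ((N G u ∩ N G v ∩ V0).card : ℝ) ≤ (N G v ∩ V0).card := by
      exact_mod_cast Finset.card_le_card
        (Finset.inter_subset_inter Finset.inter_subset_right (Finset.Subset.refl _))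
    change _ ≤ ((N G u ∩ N G v ∩ V0ᶜ).card : ℝ)
    linarith
  have hdeg1 : ∀ p ∈ V0ᶜ, (5 / 12 : ℝ) * n - 9 * (η * n) ≤ ((N G p ∩ V0).card : ℝ) := by
    intro p hp
    have e1 := split_card (N G p) V0
    have e2 := ha p hp
    have r := (R p).1
    linarith
  have hQ : ∀ p ∈ V0ᶜ, ∀ y ∈ V0ᶜ, (n:ℝ) / 8 ≤ (((N G p ∩ V0) ∩ (N G y ∩ V0)).card : ℝ) := by
    intro p hp y hy
    have e1 := hdeg1 p hp
    have e2 := hdeg1 y hy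
    have e3 := inter_ge (N G p ∩ V0) (N G y ∩ V0) V0 Finset.inter_subset_right
      Finset.inter_subset_right
    linarith
  let F2 : Fin n → Finset (Fin n × Fin n) := fun p =>
    Finset.univ.filter (fun a => a.1 ∈ Y ∧ a.2 ∈ (N G p ∩ V0) ∩ (N G a.1 ∩ V0))
  have hF2 : ∀ p ∈ V0ᶜ, (n:ℝ) / 48 * (n / 8) ≤ ((F2 p).card : ℝ) := by
    intro p hp
    have := pc Y (fun y => (N G p ∩ V0) ∩ (N G y ∩ V0)) (F2 p) (fun y q => (y, q)) (by
        intro a b c d h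
        simpa using h) (by
        intro y hy q hq
        simp only [F2, Finset.mem_filter, Finset.mem_univ, true_and]
        exact ⟨hy, hq⟩) (n / 8) (fun y hy => hQ p hp y (Finset.mem_inter.1 hy).2)
    refine le_trans ?_ this
    exact mul_le_mul_of_nonneg_right hY (by positivity)
  let F1 : Fin n → Finset (Fin n × Fin n × Fin n) := fun x =>
    Finset.univ.filter (fun a => a.1 ∈ N G x ∩ V0ᶜ ∧ a.2 ∈ F2 a.1)
  have hF1 : ∀ x ∈ X, (n:ℝ) / 4 * ((n:ℝ) / 48 * (n / 8)) ≤ ((F1 x).card : ℝ) := by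
    intro x hx
    have := pc (N G x ∩ V0ᶜ) F2 (F1 x) (fun y q => (y, q)) (by
        intro a b c d h
        simpa using h) (by
        intro y hy q hq
        simp only [F1, Finset.mem_filter, Finset.mem_univ, true_and]
        exact ⟨hy, hq⟩) _ (fun y hy => hF2 y (Finset.mem_inter.1 hy).2)
    refine le_trans ?_ this
    refine mul_le_mul_of_nonneg_right ?_ (by positivity)
    have hx2 := Finset.mem_sdiff.1 hx
    have hx3 : ((N G x ∩ V0).card : ℝ) < n / 12 := by
      by_contra hcon
      push Not at hcon
      exact hx2.2 (Finset.mem_filter.2 ⟨(Finset.mem_inter.1 hx2.1).2, hcon⟩)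
    have e1 := split_card (N G x) V0
    have r := (R x).1
    linarith
  have hfin := pc X F1 (cycV G u) (fun x a => (x, a.1, a.2.2, a.2.1)) (by
        rintro x x' ⟨a, b, c⟩ ⟨a', b', c'⟩ h
        simp only [Prod.mk.injEq] at h ⊢
        tauto) (by
        rintro x hx ⟨p, y, q⟩ ha
        simp only [X, Y, F1, F2, Finset.mem_filter, Finset.mem_univ, true_and, Finset.mem_sdiff,
          Finset.mem_inter, mem_N] at hx ha
        simp only [cycV, Finset.mem_filter, Finset.mem_univ, true_and]
        exact ⟨hx.1.1, ha.1.1, ha.2.2.1.1, ha.2.2.2.1.symm, ha.2.1.1.1⟩) _ hF1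
  have r := (R u).2.2.2
  have hX : (X.card : ℝ) ≤ 1536 * (η * n) := by
    have : (n:ℝ) ^ 3 * (X.card : ℝ) ≤ n ^ 3 * (1536 * (η * n)) := by nlinarith
    exact le_of_mul_le_mul_left this (by positivity)
  have hle : ((N G u ∩ V0).card : ℝ) ≤ X.card + At.card := by
    have : (N G u ∩ V0).card ≤ X.card + At.card :=
      Finset.card_le_card_sdiff_add_card
    exact_mod_cast this
  linarith

end struct

end FCP

namespace FCP

/-! ### Exact structure -/

section exact_structure

/-- one side of the partition -/
def Sd {n : ℕ} (P : Fin n → Bool) (b : Bool) : Finset (Fin n) :=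
  Finset.univ.filter (fun v => P v = b)

lemma mem_Sd {n : ℕ} {P : Fin n → Bool} {b : Bool} {v : Fin n} : v ∈ Sd P b ↔ P v = b := by
  simp [Sd]

lemma Sd_compl {n : ℕ} (P : Fin n → Bool) (b : Bool) : (Sd P b)ᶜ = Sd P (!b) := by
  ext v
  rw [Finset.mem_compl, mem_Sd, mem_Sd]
  cases P v <;> cases b <;> simp

/-- approximate structure with explicit error `e` -/
structure Ctx {n : ℕ} (G : SimpleGraph (Fin n)) (P : Fin n → Bool) (e : ℝ) : Prop where
  e_one : 1 ≤ e
  e_n : e * 10 ^ 6 = n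
  own : ∀ u, ((N G u ∩ Sd P (P u)).card : ℝ) ≤ e
  lo : ∀ u, 5 / 12 * (n : ℝ) - e ≤ (N G u).card
  hi : ∀ u, ((N G u).card : ℝ) ≤ 5 / 12 * (n : ℝ) + e

variable {n : ℕ} {G : SimpleGraph (Fin n)} {P : Fin n → Bool} {e : ℝ}

lemma Ctx.cross (C : Ctx G P e) (u : Fin n) :
    5 / 12 * (n : ℝ) - 2 * e ≤ (N G u ∩ Sd P (!P u)).card := by
  have h1 := split_card (N G u) (Sd P (P u))
  rw [Sd_compl] at h1
  linarith [C.own u, C.lo u]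

lemma Ctx.size_le (C : Ctx G P e) (b : Bool) : ((Sd P b).card : ℝ) ≤ n / 2 + 10 * e := by
  let Q : Finset (Fin n × Fin n) := (Sd P b ×ˢ Sd P (!b)).filter (fun p => G.Adj p.1 p.2)
  have h1 := pc (Sd P b) (fun p => N G p ∩ Sd P (!b)) Q (fun p q => (p, q)) (by
      intro a b c d h
      simpa using h) (by
      intro p hp q hq
      rw [Finset.mem_inter, mem_N] at hq
      rw [Finset.mem_filter, Finset.mem_product]
      exact ⟨⟨hp, hq.2⟩, hq.1⟩) (5 / 12 * (n : ℝ) - 2 * e) (by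
      intro p hp
      rw [mem_Sd] at hp
      subst hp
      exact C.cross p)
  have h2 : Q.card ≤ ((Sd P (!b)).sigma (fun q => N G q)).card := by
    refine Finset.card_le_card_of_injOn (fun p => ⟨p.2, p.1⟩) ?_ ?_
    · rintro ⟨p, q⟩ h
      rw [Finset.mem_coe, Finset.mem_filter, Finset.mem_product] at h
      rw [Finset.mem_coe, Finset.mem_sigma, mem_N]
      exact ⟨h.1.2, h.2.symm⟩
    · rintro ⟨p, q⟩ - ⟨p', q'⟩ - h
      simp only [Sigma.mk.injEq, heq_eq_eq] at h
      rw [h.1, h.2]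
  rw [Finset.card_sigma] at h2
  have h3 : ∑ q ∈ Sd P (!b), ((N G q).card : ℝ) ≤ (Sd P (!b)).card * (5 / 12 * (n : ℝ) + e) := by
    rw [← nsmul_eq_mul]
    exact Finset.sum_le_card_nsmul _ _ _ (fun q _ => C.hi q)
  have h4 : (Q.card : ℝ) ≤ ∑ q ∈ Sd P (!b), ((N G q).card : ℝ) := by exact_mod_cast h2
  have h5 := compl_card (Sd P b)
  rw [Sd_compl] at h5
  have h6 := h1.trans (h4.trans h3)
  rw [h5, ← C.e_n] at h6
  rw [← C.e_n]
  have he := C.e_one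
  have h7 : e * (((Sd P b).card : ℝ) * (5 / 12 * 10 ^ 6 - 2)) ≤
      e * ((e * 10 ^ 6 - (Sd P b).card) * (5 / 12 * 10 ^ 6 + 1)) := by
    calc _ = ((Sd P b).card : ℝ) * (5 / 12 * (e * 10 ^ 6) - 2 * e) := by ring
      _ ≤ _ := h6
      _ = _ := by ring
  have h8 := le_of_mul_le_mul_left h7 (by linarith)
  linarith

lemma Ctx.size_ge (C : Ctx G P e) (b : Bool) : n / 2 - 10 * e ≤ ((Sd P b).card : ℝ) := by
  have h5 := compl_card (Sd P b)
  rw [Sd_compl] at h5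
  linarith [C.size_le (!b)]

/-- removing few neighbours -/
lemma Ctx.sdiff_ge (C : Ctx G P e) (X : Finset (Fin n)) (w : Fin n) (hX : X ⊆ Sd P (P w)) :
    (X.card : ℝ) - e ≤ (X \ N G w).card := by
  have h1 : X.card ≤ (X \ N G w).card + (N G w ∩ Sd P (P w)).card := by
    rw [← Finset.card_sdiff_add_card_inter X (N G w)]
    refine Nat.add_le_add_left (Finset.card_le_card ?_) _
    intro x hx
    rw [Finset.mem_inter] at hx ⊢
    exact ⟨hx.2, hX hx.1⟩
  have h2 : (X.card : ℝ) ≤ (X \ N G w).card + (N G w ∩ Sd P (P w)).card := by exact_mod_cast h1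
  linarith [C.own w]

lemma sdiff_ge_deg (X Y : Finset (Fin n)) :
    (X.card : ℝ) - Y.card ≤ (X \ Y).card := by
  have h1 : X.card ≤ (X \ Y).card + Y.card := Finset.card_le_card_sdiff_add_card
  have h2 : (X.card : ℝ) ≤ (X \ Y).card + Y.card := by exact_mod_cast h1
  linarith

/-- common neighbours on the other side -/
noncomputable def D0 (G : SimpleGraph (Fin n)) (P : Fin n → Bool) (u u' : Fin n) :
    Finset (Fin n) := (N G u ∩ N G u') ∩ Sd P (!P u)

lemma mem_D0 {u u' v : Fin n} : v ∈ D0 G P u u' ↔ (G.Adj u v ∧ G.Adj u' v) ∧ P v = !P u := by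
  simp only [D0, Finset.mem_inter, mem_N, mem_Sd]

lemma Ctx.D0_ge (C : Ctx G P e) (u u' : Fin n) (h : P u' = P u) :
    n / 3 - 14 * e ≤ ((D0 G P u u').card : ℝ) := by
  have h1 := C.cross u
  have h2 := C.cross u'
  rw [h] at h2
  have h3 := inter_ge (N G u ∩ Sd P (!P u)) (N G u' ∩ Sd P (!P u)) (Sd P (!P u))
    Finset.inter_subset_right Finset.inter_subset_right
  have h4 := C.size_le (!P u)
  have h5 : (N G u ∩ Sd P (!P u)) ∩ (N G u' ∩ Sd P (!P u)) = D0 G P u u' := by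
    ext v
    simp only [D0, Finset.mem_inter]
    tauto
  rw [h5] at h3
  linarith

lemma pc3 {α γ : Type*} (X : Finset α) (F : α → Finset α) (K : α → α → Finset α) (S : Finset γ)
    (f : α → α → α → γ)
    (hf : ∀ a b c a' b' c', f a b c = f a' b' c' → a = a' ∧ b = b' ∧ c = c')
    (hF : ∀ x ∈ X, ∀ y ∈ F x, ∀ z ∈ K x y, f x y z ∈ S) (c d : ℝ) (hd0 : 0 ≤ d)
    (hc : ∀ x ∈ X, c ≤ ((F x).card : ℝ))
    (hd : ∀ x ∈ X, ∀ y ∈ F x, d ≤ ((K x y).card : ℝ)) :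
    (X.card : ℝ) * (c * d) ≤ S.card := by
  refine pc X (fun x => ((F x).sigma (K x)).map (Equiv.sigmaEquivProd α α).toEmbedding) S
    (fun x p => f x p.1 p.2) ?_ ?_ (c * d) ?_
  · rintro a a' ⟨b, c⟩ ⟨b', c'⟩ h
    obtain ⟨h1, h2, h3⟩ := hf _ _ _ _ _ _ h
    exact ⟨h1, Prod.ext h2 h3⟩
  · rintro x hx ⟨y, z⟩ h
    rw [Finset.mem_map_equiv, Finset.mem_sigma] at h
    exact hF x hx y h.1 z h.2
  · intro x hx
    rw [Finset.card_map, Finset.card_sigma]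
    push_cast
    refine le_trans (mul_le_mul_of_nonneg_right (hc x hx) hd0) ?_
    rw [← nsmul_eq_mul]
    exact Finset.card_nsmul_le_sum _ _ _ (hd x hx)

/-- edge deletion, as a hypothesis -/
def Del (G G' : SimpleGraph (Fin n)) (u u' : Fin n) : Prop :=
  ∀ a b, G'.Adj a b ↔ G.Adj a b ∧ ¬ ((a = u ∧ b = u') ∨ (a = u' ∧ b = u))

lemma Del.symm {G G' : SimpleGraph (Fin n)} {u u' : Fin n} (h : Del G G' u u') :
    Del G G' u' u := by
  intro a b
  rw [h a b, or_comm]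

lemma Ctx.gain1 (C : Ctx G P e) (G' : SimpleGraph (Fin n)) (u u' : Fin n) (huv : G.Adj u u')
    (h : P u' = P u) (hD : Del G G' u u') :
    (((N G u \ N G u').card : ℝ) - e) * ((n / 3 - 15 * e) * (n / 3 - 17 * e)) ≤
      ((E G' \ E G).filter (fun x => x 0 = u ∧ x 2 = u')).card := by
  have he := C.e_one
  have hen := C.e_n
  have h1 : ((N G u \ N G u').card : ℝ) - e ≤ ((N G u \ N G u') ∩ Sd P (!P u)).card := by
    have h1 := split_card (N G u \ N G u') (Sd P (P u))
    rw [Sd_compl] at h1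
    have h2 : (((N G u \ N G u') ∩ Sd P (P u)).card : ℝ) ≤ (N G u ∩ Sd P (P u)).card := by
      exact_mod_cast Finset.card_le_card
        (Finset.inter_subset_inter Finset.sdiff_subset (Finset.Subset.refl _))
    linarith [C.own u]
  refine le_trans (mul_le_mul_of_nonneg_right h1 ?_) (pc3 ((N G u \ N G u') ∩ Sd P (!P u))
    (fun z => D0 G P u u' \ N G z) (fun z y => ((D0 G P u u' \ N G z) \ N G y).erase y)
    _ (fun z y w => ![u, y, u', w, z]) ?_ ?_ _ _ ?_ ?_ ?_)
  · refine mul_nonneg ?_ ?_ <;> linarith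
  · intro a b c a' b' c' hh
    have t1 := congrFun hh 1
    have t3 := congrFun hh 3
    have t4 := congrFun hh 4
    simp only [Matrix.cons_val] at t1 t3 t4
    exact ⟨t4, t1, t3⟩
  · intro z hz y hy w hw
    simp only [Finset.mem_inter, Finset.mem_sdiff, Finset.mem_erase, mem_N, mem_Sd, mem_D0]
      at hz hy hw
    obtain ⟨⟨hz1, hz2⟩, hz3⟩ := hz
    obtain ⟨⟨⟨hy1, hy2⟩, hy3⟩, hy4⟩ := hy
    obtain ⟨hw0, ⟨⟨⟨hw1, hw2⟩, hw3⟩, hw4⟩, hw5⟩ := hw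
    have ne : ∀ v, P v = !P u → v ≠ u ∧ v ≠ u' := by
      intro v hv
      constructor
      · rintro rfl
        cases hh : P v <;> simp [hh] at hv
      · rintro rfl
        rw [h] at hv
        cases hh : P u <;> simp [hh] at hv
    have nz := ne z hz3
    have ny := ne y hy3
    have nw := ne w hw3
    have huu : u ≠ u' := huv.ne
    rw [Finset.mem_filter, Finset.mem_sdiff, mem_E, mem_E]
    refine ⟨⟨?_, ?_⟩, rfl, rfl⟩
    · refine ⟨?_, ?_, ?_, ?_, ?_, ?_, ?_, ?_, ?_, ?_, ?_⟩ <;>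
        simp only [Matrix.cons_val, hD _ _]
      · exact ⟨hy1, by tauto⟩
      · exact ⟨hy2.symm, by tauto⟩
      · exact ⟨hw2, by tauto⟩
      · exact ⟨hw1, by tauto⟩
      · exact ⟨hz1, by tauto⟩
      · tauto
      · exact fun hh => hw5 hh.1
      · exact fun hh => hy4 hh.1.symm
      · exact fun hh => hz2 hh.1
      · exact fun hh => hw4 hh.1.symm
      · exact fun hh => hw0 hh.symm
    · intro hg
      exact hg.2.2.2.2.2.1 huv
  · linarith
  · intro z hz
    have hz3 := (Finset.mem_inter.1 hz).2
    rw [mem_Sd] at hz3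
    have := C.sdiff_ge (D0 G P u u') z (by rw [hz3]; exact Finset.inter_subset_right)
    linarith [C.D0_ge u u' h]
  · intro z hz y hy
    have hz3 := (Finset.mem_inter.1 hz).2
    rw [mem_Sd] at hz3
    have a1 := C.sdiff_ge (D0 G P u u') z (by rw [hz3]; exact Finset.inter_subset_right)
    have hy3 := (mem_D0.1 (Finset.mem_sdiff.1 hy).1).2
    have a2 := C.sdiff_ge (D0 G P u u' \ N G z) y
      (by rw [hy3]; exact Finset.sdiff_subset.trans Finset.inter_subset_right)
    have a3 := Finset.pred_card_le_card_erase (s := (D0 G P u u' \ N G z) \ N G y) (a := y)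
    have a4 : (((D0 G P u u' \ N G z) \ N G y).card : ℝ) ≤
        (((D0 G P u u' \ N G z) \ N G y).erase y).card + 1 := by
      have : ((D0 G P u u' \ N G z) \ N G y).card ≤
        (((D0 G P u u' \ N G z) \ N G y).erase y).card + 1 := by omega
      exact_mod_cast this
    linarith [C.D0_ge u u' h]

lemma Ctx.gain2 (C : Ctx G P e) (G' : SimpleGraph (Fin n)) (u u' : Fin n) (huv : G.Adj u u')
    (h : P u' = P u) (hD : Del G G' u u') :
    (n / 3 - 14 * e) * ((n / 12 - 13 * e) * (n / 4 - 27 * e)) ≤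
      ((E G' \ E G).filter (fun x => x 1 = u ∧ x 3 = u')).card := by
  have he := C.e_one
  have hen := C.e_n
  refine le_trans (mul_le_mul_of_nonneg_right (C.D0_ge u u' h) ?_) (pc3 (D0 G P u u')
    (fun y => ((Sd P (P u) \ N G u) \ N G u') \ N G y) (fun y z => (N G z ∩ D0 G P u u') \ N G y)
    _ (fun y z w => ![w, u, y, u', z]) ?_ ?_ _ _ ?_ ?_ ?_)
  · refine mul_nonneg ?_ ?_ <;> linarith
  · intro a b c a' b' c' hh
    have t1 := congrFun hh 0
    have t3 := congrFun hh 2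
    have t4 := congrFun hh 4
    simp only [Matrix.cons_val] at t1 t3 t4
    exact ⟨t3, t4, t1⟩
  · intro y hy z hz w hw
    simp only [Finset.mem_inter, Finset.mem_sdiff, mem_N, mem_Sd, mem_D0]
      at hz hy hw
    obtain ⟨⟨hy1, hy2⟩, hy3⟩ := hy
    obtain ⟨⟨⟨hz1, hz2⟩, hz3⟩, hz4⟩ := hz
    obtain ⟨⟨hw0, ⟨hw1, hw2⟩, hw3⟩, hw4⟩ := hw
    have ne : ∀ v, P v = !P u → v ≠ u ∧ v ≠ u' := by
      intro v hv
      constructor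
      · rintro rfl
        cases hh : P v <;> simp [hh] at hv
      · rintro rfl
        rw [h] at hv
        cases hh : P u <;> simp [hh] at hv
    have ny := ne y hy3
    have nw := ne w hw3
    have huu : u ≠ u' := huv.ne
    have nz : z ≠ u ∧ z ≠ u' := by
      constructor
      · rintro rfl
        exact hz3 huv.symm
      · rintro rfl
        exact hz2 huv
    rw [Finset.mem_filter, Finset.mem_sdiff, mem_E, mem_E]
    refine ⟨⟨?_, ?_⟩, rfl, rfl⟩
    · refine ⟨?_, ?_, ?_, ?_, ?_, ?_, ?_, ?_, ?_, ?_, ?_⟩ <;>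
        simp only [Matrix.cons_val, hD _ _]
      · exact ⟨hw1.symm, by tauto⟩
      · exact ⟨hy1, by tauto⟩
      · exact ⟨hy2.symm, by tauto⟩
      · exact ⟨hw2.symm, by tauto⟩
      · exact ⟨hw0.symm, by tauto⟩
      · exact fun hh => hw4 hh.1.symm
      · tauto
      · exact fun hh => hz2 hh.1
      · exact fun hh => hz4 hh.1
      · exact fun hh => hz3 hh.1
      · exact huu
    · intro hg
      exact hg.2.2.2.2.2.2.1 huv
  · linarith
  · intro y hy
    have a1 := C.sdiff_ge (Sd P (P u)) u (Finset.Subset.refl _)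
    have a2 := C.sdiff_ge (Sd P (P u) \ N G u) u' (by rw [h]; exact Finset.sdiff_subset)
    have a3 := sdiff_ge_deg ((Sd P (P u) \ N G u) \ N G u') (N G y)
    have a4 := C.size_ge (P u)
    have a5 := C.hi y
    linarith
  · intro y hy z hz
    simp only [Finset.mem_sdiff, mem_Sd, mem_D0] at hy hz
    have a1 := C.cross z
    rw [hz.1.1.1] at a1
    have a2 := C.D0_ge u u' h
    have a3 := inter_ge (N G z ∩ Sd P (!P u)) (D0 G P u u') (Sd P (!P u))
      Finset.inter_subset_right Finset.inter_subset_right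
    have a4 : (N G z ∩ Sd P (!P u)) ∩ D0 G P u u' = N G z ∩ D0 G P u u' := by
      ext v
      simp only [D0, Finset.mem_inter]
      tauto
    rw [a4] at a3
    have a5 := C.sdiff_ge (N G z ∩ D0 G P u u') y (by
      rw [hy.2]; exact Finset.inter_subset_right.trans Finset.inter_subset_right)
    have a6 := C.size_le (!P u)
    linarith

/-- losses through the pendant edge -/
lemma Ctx.loss1 (C : Ctx G P e) (u u' : Fin n) :
    (((E G).filter (fun x => x 0 = u ∧ x 4 = u')).card : ℝ) ≤
      ((N G u \ N G u').card : ℝ) ^ 2 * (5 / 12 * n + e) := by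
  have h1 : ((E G).filter (fun x => x 0 = u ∧ x 4 = u')).card ≤
      (((N G u \ N G u') ×ˢ (N G u \ N G u')).sigma (fun p => N G p.1)).card := by
    refine Finset.card_le_card_of_injOn (fun x => ⟨(x 1, x 3), x 2⟩) ?_ ?_
    · intro x hx
      rw [Finset.mem_coe, Finset.mem_filter, mem_E] at hx
      obtain ⟨⟨h1, h2, h3, h4, h5, h6, h7, h8, h9, h10, -⟩, hu, hu'⟩ := hx
      rw [hu] at h1 h4
      rw [hu'] at h8 h10
      simp only [Finset.mem_coe, Finset.mem_sigma, Finset.mem_product, Finset.mem_sdiff, mem_N]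
      exact ⟨⟨⟨h1, fun h => h8 h.symm⟩, ⟨h4, fun h => h10 h.symm⟩⟩, h2⟩
    · intro x hx y hy hxy
      rw [Finset.mem_coe, Finset.mem_filter] at hx hy
      simp only [Sigma.mk.injEq, Prod.mk.injEq, heq_eq_eq] at hxy
      funext i
      fin_cases i
      · exact hx.2.1.trans hy.2.1.symm
      · exact hxy.1.1
      · exact hxy.2
      · exact hxy.1.2
      · exact hx.2.2.trans hy.2.2.symm
  rw [Finset.card_sigma] at h1
  have h2 : (((E G).filter (fun x => x 0 = u ∧ x 4 = u')).card : ℝ) ≤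
      ∑ p ∈ (N G u \ N G u') ×ˢ (N G u \ N G u'), ((N G p.1).card : ℝ) := by exact_mod_cast h1
  refine h2.trans ((Finset.sum_le_card_nsmul _ _ _ (fun p _ => C.hi p.1)).trans (le_of_eq ?_))
  rw [nsmul_eq_mul, Finset.card_product]
  push_cast
  ring

/-- a tuple with a monochromatic edge with a free endpoint -/
noncomputable def badB (G : SimpleGraph (Fin n)) (P : Fin n → Bool) (u u' : Fin n)
    (i j p q : Fin 5) : Finset (Fin 5 → Fin n) :=
  Finset.univ.filter (fun x => x i = u ∧ x j = u' ∧ G.Adj (x p) (x q) ∧ P (x q) = P (x p))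

lemma Ctx.bad_card (C : Ctx G P e) (u u' : Fin n) (i j p q : Fin 5)
    (hij : i ≠ j) (hqi : q ≠ i) (hqj : q ≠ j) (hqp : q ≠ p) :
    ((badB G P u u' i j p q).card : ℝ) ≤ e * (n : ℝ) ^ 2 := by
  let I : Finset (Fin 5) := {i, j, q}
  have hI : I.card = 3 := by
    rw [Finset.card_eq_three]
    exact ⟨i, j, q, hij, hqi.symm, hqj.symm, rfl⟩
  have hcard : Fintype.card ({k : Fin 5 // k ∉ I} → Fin n) = n ^ 2 := by
    rw [Fintype.card_fun, Fintype.card_fin, Fintype.card_subtype_compl, Fintype.card_coe, hI]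
    rfl
  have hown : ∀ w, (N G w ∩ Sd P (P w)).card ≤ ⌊e⌋₊ := fun w => Nat.le_floor (C.own w)
  have h1 := Finset.card_le_mul_card_image (f := fun x : Fin 5 → Fin n =>
    (fun k : {k : Fin 5 // k ∉ I} => x k.1)) (badB G P u u' i j p q) ⌊e⌋₊ (by
    intro g hg
    rw [Finset.mem_image] at hg
    obtain ⟨x0, hx0, hg⟩ := hg
    refine le_trans ?_ (hown (x0 p))
    have key : ∀ x ∈ (badB G P u u' i j p q), (fun k : {k : Fin 5 // k ∉ I} => x k.1) = g →
        ∀ k, k ≠ q → x k = x0 k := by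
      intro x hx hxg k hk
      simp only [badB, Finset.mem_filter, Finset.mem_univ, true_and] at hx hx0
      by_cases hki : k = i
      · subst hki; rw [hx.1, hx0.1]
      by_cases hkj : k = j
      · subst hkj; rw [hx.2.1, hx0.2.1]
      rw [← hg] at hxg
      exact congrFun hxg ⟨k, by simp [I, hki, hkj, hk]⟩
    refine Finset.card_le_card_of_injOn (fun x => x q) ?_ ?_
    · intro x hx
      rw [Finset.mem_coe, Finset.mem_filter] at hx
      have h2 := key x hx.1 hx.2 p hqp.symm
      have h3 := hx.1
      simp only [badB, Finset.mem_filter, Finset.mem_univ, true_and] at h3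
      rw [h2] at h3
      rw [Finset.mem_coe, Finset.mem_inter, mem_N, mem_Sd]
      exact h3.2.2
    · intro x hx y hy hxy
      rw [Finset.mem_coe, Finset.mem_filter] at hx hy
      funext k
      by_cases hk : k = q
      · subst hk; exact hxy
      · rw [key x hx.1 hx.2 k hk, key y hy.1 hy.2 k hk])
  have h2 : (badB G P u u' i j p q).card ≤ ⌊e⌋₊ * n ^ 2 := by
    refine h1.trans (Nat.mul_le_mul_left _ ?_)
    rw [← hcard]
    exact Finset.card_le_univ _
  have h3 : ((badB G P u u' i j p q).card : ℝ) ≤ (⌊e⌋₊ : ℝ) * (n:ℝ) ^ 2 := by exact_mod_cast h2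
  refine h3.trans (mul_le_mul_of_nonneg_right (Nat.floor_le (by linarith [C.e_one])) (by positivity))

/-- index set of bad configurations -/
def badI : Finset (Fin 5 × Fin 5 × Fin 5 × Fin 5) :=
  Finset.univ.filter (fun t => t.1 ≠ t.2.1 ∧ t.2.2.2 ≠ t.1 ∧ t.2.2.2 ≠ t.2.1 ∧ t.2.2.2 ≠ t.2.2.1)

lemma Ctx.loss (C : Ctx G P e) (G' : SimpleGraph (Fin n)) (u u' : Fin n) (huv : G.Adj u u')
    (h : P u' = P u) (hD : Del G G' u u') :
    ((E G \ E G').card : ℝ) ≤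
      ((N G u \ N G u').card : ℝ) ^ 2 * (5 / 12 * n + e) +
      ((N G u' \ N G u).card : ℝ) ^ 2 * (5 / 12 * n + e) + 625 * (e * (n : ℝ) ^ 2) := by
  have hsub : E G \ E G' ⊆ (((E G).filter (fun x => x 0 = u ∧ x 4 = u')) ∪
      ((E G).filter (fun x => x 0 = u' ∧ x 4 = u))) ∪
      badI.biUnion (fun t => badB G P u u' t.1 t.2.1 t.2.2.1 t.2.2.2) := by
    intro x hx
    rw [Finset.mem_sdiff, mem_E, mem_E] at hx
    obtain ⟨hg, hng⟩ := hx
    have hg0 := hg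
    obtain ⟨h1, h2, h3, h4, h5, h6, h7, h8, h9, h10, h11⟩ := hg
    rw [Finset.mem_union, Finset.mem_union]
    -- monochromatic path lemma
    have path : ∀ i j k l : Fin 5, x i = u → x j = u' → G.Adj (x j) (x k) → G.Adj (x k) (x l) →
        G.Adj (x l) (x i) → i ≠ j → i ≠ k → i ≠ l → j ≠ k → j ≠ l → k ≠ l →
        x ∈ badI.biUnion (fun t => badB G P u u' t.1 t.2.1 t.2.2.1 t.2.2.2) := by
      intro i j k l hi hj a1 a2 a3 n1 n2 n3 n4 n5 n6
      rw [Finset.mem_biUnion]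
      have hp : P (x k) = P (x j) ∨ P (x l) = P (x k) ∨ P (x l) = P (x i) := by
        rw [hi, hj, h]
        cases P (x k) <;> cases P (x l) <;> cases P u <;> simp
      rcases hp with hp | hp | hp
      · refine ⟨(i, j, j, k), ?_, ?_⟩
        · simp only [badI, Finset.mem_filter, Finset.mem_univ, true_and]
          exact ⟨n1, n2.symm, n4.symm, n4.symm⟩
        · simp only [badB, Finset.mem_filter, Finset.mem_univ, true_and]
          exact ⟨hi, hj, a1, hp⟩
      · refine ⟨(i, j, k, l), ?_, ?_⟩
        · simp only [badI, Finset.mem_filter, Finset.mem_univ, true_and]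
          exact ⟨n1, n3.symm, n5.symm, n6.symm⟩
        · simp only [badB, Finset.mem_filter, Finset.mem_univ, true_and]
          exact ⟨hi, hj, a2, hp⟩
      · refine ⟨(i, j, i, l), ?_, ?_⟩
        · simp only [badI, Finset.mem_filter, Finset.mem_univ, true_and]
          exact ⟨n1, n3.symm, n5.symm, n3.symm⟩
        · simp only [badB, Finset.mem_filter, Finset.mem_univ, true_and]
          exact ⟨hi, hj, a3.symm, hp⟩
    by_contra hcon
    push Not at hcon
    obtain ⟨⟨c1, c2⟩, c3⟩ := hcon
    rw [Finset.mem_filter, mem_E] at c1 c2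
    apply hng
    refine ⟨(hD _ _).2 ⟨h1, ?_⟩, (hD _ _).2 ⟨h2, ?_⟩, (hD _ _).2 ⟨h3, ?_⟩, (hD _ _).2 ⟨h4, ?_⟩,
      (hD _ _).2 ⟨h5, ?_⟩, fun hh => h6 ((hD _ _).1 hh).1, fun hh => h7 ((hD _ _).1 hh).1,
      fun hh => h8 ((hD _ _).1 hh).1, fun hh => h9 ((hD _ _).1 hh).1,
      fun hh => h10 ((hD _ _).1 hh).1, h11⟩
    · rintro (⟨b1, b2⟩ | ⟨b1, b2⟩)
      · exact c3 (path 0 1 2 3 b1 b2 h2 h3 h4.symm (by decide) (by decide) (by decide)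
          (by decide) (by decide) (by decide))
      · exact c3 (path 1 0 3 2 b2 b1 h4 h3.symm h2.symm (by decide) (by decide) (by decide)
          (by decide) (by decide) (by decide))
    · rintro (⟨b1, b2⟩ | ⟨b1, b2⟩)
      · exact c3 (path 1 2 3 0 b1 b2 h3 h4.symm h1 (by decide) (by decide) (by decide)
          (by decide) (by decide) (by decide))
      · exact c3 (path 2 1 0 3 b2 b1 h1.symm h4 h3.symm (by decide) (by decide) (by decide)
          (by decide) (by decide) (by decide))
    · rintro (⟨b1, b2⟩ | ⟨b1, b2⟩)
      · exact c3 (path 2 3 0 1 b1 b2 h4.symm h1 h2 (by decide) (by decide) (by decide)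
          (by decide) (by decide) (by decide))
      · exact c3 (path 3 2 1 0 b2 b1 h2.symm h1.symm h4 (by decide) (by decide) (by decide)
          (by decide) (by decide) (by decide))
    · rintro (⟨b1, b2⟩ | ⟨b1, b2⟩)
      · exact c3 (path 0 3 2 1 b1 b2 h3.symm h2.symm h1.symm (by decide) (by decide) (by decide)
          (by decide) (by decide) (by decide))
      · exact c3 (path 3 0 1 2 b2 b1 h1 h2 h3 (by decide) (by decide) (by decide)
          (by decide) (by decide) (by decide))
    · rintro (⟨b1, b2⟩ | ⟨b1, b2⟩)
      · exact c1 ⟨hg0, b1, b2⟩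
      · exact c2 ⟨hg0, b1, b2⟩
  have hU : ((badI.biUnion (fun t => badB G P u u' t.1 t.2.1 t.2.2.1 t.2.2.2)).card : ℝ) ≤
      625 * (e * (n : ℝ) ^ 2) := by
    have a1 : ((badI.biUnion (fun t => badB G P u u' t.1 t.2.1 t.2.2.1 t.2.2.2)).card : ℝ) ≤
        ∑ t ∈ badI, ((badB G P u u' t.1 t.2.1 t.2.2.1 t.2.2.2).card : ℝ) := by
      exact_mod_cast Finset.card_biUnion_le
    refine a1.trans ((Finset.sum_le_card_nsmul _ _ (e * (n:ℝ) ^ 2) ?_).trans ?_)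
    · intro t ht
      simp only [badI, Finset.mem_filter, Finset.mem_univ, true_and] at ht
      exact C.bad_card u u' _ _ _ _ ht.1 ht.2.1 ht.2.2.1 ht.2.2.2
    · rw [nsmul_eq_mul]
      refine mul_le_mul_of_nonneg_right ?_ (mul_nonneg (by linarith [C.e_one]) (by positivity))
      have : badI.card ≤ 625 := (Finset.card_le_univ _).trans (by simp)
      exact_mod_cast this
  have hL := (Finset.card_le_card hsub).trans (Finset.card_union_le _ _)
  have hL2 := Finset.card_union_le ((E G).filter (fun x => x 0 = u ∧ x 4 = u'))
      ((E G).filter (fun x => x 0 = u' ∧ x 4 = u))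
  have hL3 := hL.trans (Nat.add_le_add_right hL2 _)
  have hL4 : ((E G \ E G').card : ℝ) ≤ ((E G).filter (fun x => x 0 = u ∧ x 4 = u')).card +
      ((E G).filter (fun x => x 0 = u' ∧ x 4 = u)).card +
      (badI.biUnion (fun t => badB G P u u' t.1 t.2.1 t.2.2.1 t.2.2.2)).card := by
    exact_mod_cast hL3
  linarith [C.loss1 u u', C.loss1 u' u]

lemma Ctx.a_le (C : Ctx G P e) (u u' : Fin n) (h : P u' = P u) :
    ((N G u \ N G u').card : ℝ) ≤ n / 12 + 15 * e := by
  have h1 := Finset.card_sdiff_add_card_inter (N G u) (N G u')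
  have h2 : ((N G u \ N G u').card : ℝ) + (N G u ∩ N G u').card = (N G u).card := by
    exact_mod_cast h1
  have h3 : ((D0 G P u u').card : ℝ) ≤ (N G u ∩ N G u').card := by
    exact_mod_cast Finset.card_le_card Finset.inter_subset_left
  linarith [C.D0_ge u u' h, C.hi u]

theorem exact_part (C : Ctx G P e)
    (H : ∀ G' : SimpleGraph (Fin n), (E G').card ≤ (E G).card) (u u' : Fin n)
    (huv : G.Adj u u') : P u ≠ P u' := by
  intro heq
  have h : P u' = P u := heq.symm
  let G' := G.deleteEdges {s(u, u')}
  have hD : Del G G' u u' := by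
    intro a b
    simp [G', SimpleGraph.deleteEdges_adj]
  have g1 := C.gain1 G' u u' huv h hD
  have g1' := C.gain1 G' u' u huv.symm heq hD.symm
  have g2 := C.gain2 G' u u' huv h hD
  have l := C.loss G' u u' huv h hD
  have huu := huv.ne
  have hK : ((E G' \ E G).filter (fun x => x 0 = u ∧ x 2 = u')).card +
      ((E G' \ E G).filter (fun x => x 0 = u' ∧ x 2 = u)).card +
      ((E G' \ E G).filter (fun x => x 1 = u ∧ x 3 = u')).card ≤ (E G' \ E G).card := by
    rw [← Finset.card_union_of_disjoint, ← Finset.card_union_of_disjoint]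
    · refine Finset.card_le_card ?_
      exact Finset.union_subset (Finset.union_subset (Finset.filter_subset _ _)
        (Finset.filter_subset _ _)) (Finset.filter_subset _ _)
    · rw [Finset.disjoint_left]
      intro x hx hx'
      rw [Finset.mem_union, Finset.mem_filter, Finset.mem_filter] at hx
      rw [Finset.mem_filter, Finset.mem_sdiff, mem_E] at hx'
      have hinj := good_inj hx'.1.1
      rcases hx with hx | hx
      · exact absurd (hinj (hx.2.1.trans hx'.2.1.symm)) (by decide)
      · exact absurd (hinj (hx.2.1.trans hx'.2.2.symm)) (by decide)
    · rw [Finset.disjoint_left]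
      intro x hx hx'
      rw [Finset.mem_filter] at hx hx'
      exact huu (hx.2.1.symm.trans hx'.2.1)
  have hKL : (E G' \ E G).card ≤ (E G \ E G').card := by
    have a1 := Finset.card_sdiff_add_card_inter (E G') (E G)
    have a2 := Finset.card_sdiff_add_card_inter (E G) (E G')
    rw [Finset.inter_comm] at a2
    have := H G'
    omega
  have hKr : (((E G' \ E G).filter (fun x => x 0 = u ∧ x 2 = u')).card : ℝ) +
      ((E G' \ E G).filter (fun x => x 0 = u' ∧ x 2 = u)).card +
      ((E G' \ E G).filter (fun x => x 1 = u ∧ x 3 = u')).card ≤ (E G \ E G').card := by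
    exact_mod_cast hK.trans hKL
  have ha := C.a_le u u' h
  have ha' := C.a_le u' u heq
  have he := C.e_one
  have hen := C.e_n
  set a : ℝ := ((N G u \ N G u').card : ℝ) with ha_def
  set a' : ℝ := ((N G u' \ N G u).card : ℝ) with ha'_def
  have a0 : 0 ≤ a := by positivity
  have a0' : 0 ≤ a' := by positivity
  have main := hKr.trans l
  have main2 : (a - e) * ((n / 3 - 15 * e) * (n / 3 - 17 * e)) +
      (a' - e) * ((n / 3 - 15 * e) * (n / 3 - 17 * e)) +
      (n / 3 - 14 * e) * ((n / 12 - 13 * e) * (n / 4 - 27 * e)) ≤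
      a ^ 2 * (5 / 12 * n + e) + a' ^ 2 * (5 / 12 * n + e) + 625 * (e * (n : ℝ) ^ 2) := by
    linarith
  rw [← hen] at main2 ha ha'
  have q1 : a ^ 2 ≤ a * (e * 83349) := by
    rw [sq]
    refine mul_le_mul_of_nonneg_left ?_ a0
    linarith
  have q1' : a' ^ 2 ≤ a' * (e * 83349) := by
    rw [sq]
    refine mul_le_mul_of_nonneg_left ?_ a0'
    linarith
  have q2 : a ^ 2 * e ≤ a * (e * 83349) * e := mul_le_mul_of_nonneg_right q1 (by linarith)
  have q2' : a' ^ 2 * e ≤ a' * (e * 83349) * e := mul_le_mul_of_nonneg_right q1' (by linarith)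
  have e3 : 0 < e ^ 3 := by positivity
  have e2a : 0 ≤ a * e ^ 2 := by positivity
  have e2a' : 0 ≤ a' * e ^ 2 := by positivity
  nlinarith

end exact_structure

end FCP

theorem extremal_four_cycle_pendant :
    ∀ ε : ℝ, 0 < ε → ∃ n₀ : ℕ, ∀ n : ℕ, n₀ ≤ n → ∀ G : SimpleGraph (Fin n),
      lamF fourCyclePendant G = lamFmax fourCyclePendant n →
        ∃ P : Fin n → Bool,
          (∀ u v, G.Adj u v → P u ≠ P v) ∧
          ∀ u : Fin n,
            (5/12 - ε) * (n : ℝ) ≤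
              ((Finset.univ.filter (fun v => G.Adj u v ∧ P v ≠ P u)).card : ℝ) ∧
            ((Finset.univ.filter (fun v => G.Adj u v ∧ P v ≠ P u)).card : ℝ) ≤
              (5/12 + ε) * (n : ℝ) := by
  intro ε hε
  obtain ⟨η, hη0, hηε, hη⟩ : ∃ η : ℝ, 0 < η ∧ η ≤ ε ∧ η ≤ 1/10^10 :=
    ⟨min ε (1/10^10), lt_min hε (by norm_num), min_le_left _ _, min_le_right _ _⟩
  obtain ⟨m, hm⟩ := FCP.vertex_reg η hη0 (by norm_num at hη ⊢; linarith)
  refine ⟨max m (10^6), ?_⟩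
  intro n hn G hG
  have hn1 : m ≤ n := le_trans (le_max_left _ _) hn
  have hn2 : 10^6 ≤ n := le_trans (le_max_right _ _) hn
  have hn3 : (10:ℝ)^6 ≤ (n:ℝ) := by exact_mod_cast hn2
  have hn0 : (0:ℝ) < n := lt_of_lt_of_le (by norm_num) hn3
  have H := FCP.extremal_E (by omega) G hG
  have R := hm n hn1 G H
  have hηn : η * n ≤ 1/10^10 * n := mul_le_mul_of_nonneg_right hη hn0.le
  have hηεn : η * n ≤ ε * n := mul_le_mul_of_nonneg_right hηε hn0.le
  obtain ⟨V0, hA, hB⟩ := FCP.approx G η hη0 (by norm_num at hη ⊢; linarith) (by omega) R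
  have C : FCP.Ctx G (fun u => decide (u ∈ V0)) ((n:ℝ)/10^6) := by
    refine ⟨?_, ?_, ?_, ?_, ?_⟩
    · rw [le_div_iff₀ (by norm_num)]; linarith
    · field_simp
    · intro u
      by_cases hu : u ∈ V0
      · have e : FCP.Sd (fun u => decide (u ∈ V0)) (decide (u ∈ V0)) = V0 := by
          ext w; simp [FCP.mem_Sd, hu]
        have := hA u hu
        simp only [e]
        norm_num at *; linarith
      · have e : FCP.Sd (fun u => decide (u ∈ V0)) (decide (u ∈ V0)) = V0ᶜ := by
          ext w; simp [FCP.mem_Sd, hu]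
        have := hB u (by simpa using hu)
        simp only [e]
        norm_num at *; linarith
    · intro u
      have := (R u).1
      norm_num at *; linarith
    · intro u
      have := (R u).2.1
      norm_num at *; linarith
  have hP := FCP.exact_part C H
  refine ⟨fun u => decide (u ∈ V0), hP, fun u => ?_⟩
  have e : Finset.univ.filter (fun v => G.Adj u v ∧ decide (v ∈ V0) ≠ decide (u ∈ V0))
      = FCP.N G u := by
    ext v
    simp only [Finset.mem_filter, Finset.mem_univ, true_and, FCP.mem_N]
    exact ⟨fun h => h.1, fun h => ⟨h, (hP u v h).symm⟩⟩
  have h1 := (R u).1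
  have h2 := (R u).2.1
  rw [e]
  constructor <;> linarith
end
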